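/- Inverse weight transition through a three-dimensional saddle, second case: with the vector field ξ, the cylinder B, the map φ_x, the fence Φ̄ and the saturation as in the context, let D' ⊆ (0,1) × (0,1) be a subset of weight ρ'' > 0 at the origin and let S'_z be the saturation of Φ̄(D') by the ξ-flow in B. Then the set φ_x⁻¹(S'_z) = {(u,v) ∈ ℝ²_{>0} : (1,u,v) ∈ S'_z} has weight (μρ'')/(1 + λρ'') at the origin. -/

import Mathlib

open Filter Set

/-- A parameterized real analytic curve `c : [1,∞) → ℝ²_{>0}` with nonvanishing
derivative for `t > 1` and limit `(0,0)` at infinity. -/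
def WeightCurve (c : ℝ → ℝ × ℝ) : Prop :=
  AnalyticOnNhd ℝ c (Set.Ici 1) ∧
  (∀ t ∈ Set.Ici (1 : ℝ), 0 < (c t).1 ∧ 0 < (c t).2) ∧
  (∀ t : ℝ, 1 < t → deriv c t ≠ 0) ∧
  Tendsto c atTop (nhds (0, 0))

/-- The curve `c` has weight `ρ` at the origin:
`k₁·c₁(t)^ρ < c₂(t) < k₂·c₁(t)^ρ` for all `t > t₀`. -/
def CurveHasWeight (c : ℝ → ℝ × ℝ) (ρ : ℝ) : Prop :=
  ∃ k₁ k₂ t₀ : ℝ, 0 < k₁ ∧ k₁ < k₂ ∧ 1 < t₀ ∧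
    ∀ t : ℝ, t₀ < t → k₁ * (c t).1 ^ ρ < (c t).2 ∧ (c t).2 < k₂ * (c t).1 ^ ρ

/-- A subset `C ⊆ ℝ²_{>0}` has weight `ρ` if it is the image of a parameterized
real analytic curve of weight `ρ`. -/
def SetHasWeight (C : Set (ℝ × ℝ)) (ρ : ℝ) : Prop :=
  ∃ c : ℝ → ℝ × ℝ, WeightCurve c ∧ CurveHasWeight c ρ ∧ C = c '' Set.Ici 1

/-- The cylinder `B = {0 ≤ x ≤ 1, 0 ≤ y, 0 ≤ z, y² + z² ≤ 1}` in `ℝ³`. -/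
def Bcyl : Set (ℝ × ℝ × ℝ) :=
  {p | 0 ≤ p.1 ∧ p.1 ≤ 1 ∧ 0 ≤ p.2.1 ∧ 0 ≤ p.2.2 ∧ p.2.1 ^ 2 + p.2.2 ^ 2 ≤ 1}

/-- The saturation of `A` by the `ξ`-flow in `B`: points lying on an integral curve
of `ξ` contained in `B` that starts or ends in `A`. -/
def Saturation (ξ : ℝ × ℝ × ℝ → ℝ × ℝ × ℝ) (A : Set (ℝ × ℝ × ℝ)) : Set (ℝ × ℝ × ℝ) :=
  {p | ∃ s₀ s₁ : ℝ, s₀ ≤ s₁ ∧ ∃ γ : ℝ → ℝ × ℝ × ℝ,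
    (∀ τ ∈ Set.Icc s₀ s₁, γ τ ∈ Bcyl) ∧
    (∀ τ ∈ Set.Icc s₀ s₁, HasDerivAt γ (ξ (γ τ)) τ) ∧
    (∃ s ∈ Set.Icc s₀ s₁, γ s = p) ∧
    (γ s₀ ∈ A ∨ γ s₁ ∈ A)}

/-- The inclusion `φ_x(u,v) = (1,u,v)`. -/
def phiX (q : ℝ × ℝ) : ℝ × ℝ × ℝ := (1, q.1, q.2)

/-- The fence `Φ(u,v) = (v, cos(πu/2), sin(πu/2))`. -/
noncomputable def fencePhi (q : ℝ × ℝ) : ℝ × ℝ × ℝ :=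
  (q.2, Real.cos (Real.pi * q.1 / 2), Real.sin (Real.pi * q.1 / 2))

/-- The fence `Φ̄(u,v) = (v, sin(πu/2), cos(πu/2))`. -/
noncomputable def fencePhiBar (q : ℝ × ℝ) : ℝ × ℝ × ℝ :=
  (q.2, Real.sin (Real.pi * q.1 / 2), Real.cos (Real.pi * q.1 / 2))

/-- The domain `[0,1] × [0,1]` of the fences. -/
def fenceSquare : Set (ℝ × ℝ) := Set.Icc (0 : ℝ) 1 ×ˢ Set.Icc (0 : ℝ) 1

section Nemytskii

variable {K E F : Type*} [TopologicalSpace K] [CompactSpace K]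
  [NormedAddCommGroup E] [NormedSpace ℝ E] [NormedAddCommGroup F] [NormedSpace ℝ F]

/-- The continuous multilinear map on spaces of continuous functions obtained by applying a
continuous multilinear map pointwise. -/
noncomputable def ContinuousMultilinearMap.pointwise (K : Type*) [TopologicalSpace K]
    [CompactSpace K] {n : ℕ} (p : E [×n]→L[ℝ] F) : C(K, E) [×n]→L[ℝ] C(K, F) :=
  MultilinearMap.mkContinuous
    { toFun := fun m => ⟨fun θ => p fun i => m i θ, by fun_prop⟩
      map_update_add' := by
        intro _ m i x y
        ext θ
        have h (w : C(K, E)) : (fun j => Function.update m i w j θ)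
            = Function.update (fun j => m j θ) i (w θ) := by
          ext j
          by_cases hj : j = i
          · subst hj; simp
          · simp [hj]
        simp [h]
      map_update_smul' := by
        intro _ m i r x
        ext θ
        have h (w : C(K, E)) : (fun j => Function.update m i w j θ)
            = Function.update (fun j => m j θ) i (w θ) := by
          ext j
          by_cases hj : j = i
          · subst hj; simp
          · simp [hj]
        simp [h] }
    ‖p‖ (by
      intro m
      refine (ContinuousMap.norm_le _ (by positivity)).2 fun θ => ?_
      refine (p.le_opNorm _).trans ?_
      gcongr with i
      exact (m i).norm_coe_le_norm θ)

@[simp]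
theorem ContinuousMultilinearMap.pointwise_apply {n : ℕ} (p : E [×n]→L[ℝ] F)
    (m : Fin n → C(K, E)) (θ : K) : p.pointwise K m θ = p fun i => m i θ := rfl

theorem ContinuousMultilinearMap.norm_pointwise_le {n : ℕ} (p : E [×n]→L[ℝ] F) :
    ‖p.pointwise K‖ ≤ ‖p‖ :=
  MultilinearMap.mkContinuous_norm_le _ (norm_nonneg _) _

/-- Composition with a map `g` analytic at `q` is, near the constant function `q`, an analytic
operator on spaces of continuous functions. -/
theorem AnalyticAt.exists_analyticAt_comp_continuousMap [CompleteSpace F] {g : E → F} {q : E}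
    (hg : AnalyticAt ℝ g q) :
    ∃ N : C(K, E) → C(K, F), AnalyticAt ℝ N (ContinuousMap.const K q) ∧
      ∀ᶠ h in nhds (ContinuousMap.const K q), ∀ θ, N h θ = g (h θ) := by
  obtain ⟨p, r, hp⟩ := hg
  set P : FormalMultilinearSeries ℝ C(K, E) C(K, F) := fun n => (p n).pointwise K with hP
  have hrad : p.radius ≤ P.radius := by
    refine ENNReal.le_of_forall_nnreal_lt fun s hs => ?_
    obtain ⟨C, -, hC⟩ := p.norm_mul_pow_le_of_lt_radius hs
    exact P.le_radius_of_bound C fun n => le_trans (by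
      gcongr
      exact (p n).norm_pointwise_le) (hC n)
  have hpos : 0 < p.radius := hp.r_pos.trans_le hp.r_le
  have hPs := P.hasFPowerSeriesOnBall (hpos.trans_le hrad)
  refine ⟨fun h => P.sum (h - ContinuousMap.const K q), ?_, ?_⟩
  · have h1 : AnalyticAt ℝ P.sum (ContinuousMap.const K q - ContinuousMap.const K q) := by
      rw [sub_self]; exact hPs.analyticAt
    exact h1.comp (f := fun h => h - ContinuousMap.const K q) (by fun_prop)
  · have hball : ∀ᶠ h in nhds (ContinuousMap.const K q),
        h ∈ Metric.eball (ContinuousMap.const K q) r := Metric.eball_mem_nhds _ hp.r_pos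
    filter_upwards [hball] with h hh θ
    set d := h - ContinuousMap.const K q with hd
    have hd' : d ∈ Metric.eball 0 r := by
      rw [Metric.mem_eball, edist_eq_enorm_sub] at hh
      simpa [hd] using hh
    have hs := hPs.hasSum (y := d)
      (Metric.eball_subset_eball (hp.r_le.trans hrad) hd')
    have hs' := (ContinuousMap.evalCLM ℝ θ : C(K, F) →L[ℝ] F).hasSum hs
    have hdθ : d θ ∈ Metric.eball 0 r := by
      rw [Metric.mem_eball, edist_zero_right] at hd' ⊢
      refine lt_of_le_of_lt ?_ hd'
      rw [enorm_le_iff_norm_le]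
      exact d.norm_coe_le_norm θ
    have hs2 := hp.hasSum hdθ
    have : (q + d θ) = h θ := by simp [hd]
    rw [this] at hs2
    refine HasSum.unique ?_ hs2
    simpa [hP] using hs'

end Nemytskii

section Flow

variable {E : Type*} [NormedAddCommGroup E] [NormedSpace ℝ E]

/-- Integration from `0` as a continuous linear operator on `C([0,1], E)`. -/
noncomputable def volterra (E : Type*) [NormedAddCommGroup E] [NormedSpace ℝ E] :
    C(unitInterval, E) →L[ℝ] C(unitInterval, E) :=
  LinearMap.mkContinuous
    { toFun := fun h => ⟨fun θ => ∫ r in (0 : ℝ)..θ, IccExtend zero_le_one h r, by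
        have : Continuous fun x : ℝ => ∫ r in (0 : ℝ)..x, IccExtend zero_le_one h r :=
          intervalIntegral.continuous_primitive
            (fun a b => (h.continuous.Icc_extend' (h := zero_le_one)).intervalIntegrable a b) 0
        exact this.comp continuous_subtype_val⟩
      map_add' := by
        intro f g
        ext θ
        exact intervalIntegral.integral_add
          ((f.continuous.Icc_extend' (h := zero_le_one)).intervalIntegrable _ _)
          ((g.continuous.Icc_extend' (h := zero_le_one)).intervalIntegrable _ _)
      map_smul' := by
        intro c f
        ext θ
        exact intervalIntegral.integral_smul c _ }
    1 (by
      intro h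
      refine (ContinuousMap.norm_le _ (by positivity)).2 fun θ => ?_
      refine (intervalIntegral.norm_integral_le_of_norm_le_const (C := ‖h‖)
        fun x _ => h.norm_coe_le_norm _).trans ?_
      rw [one_mul, sub_zero, abs_of_nonneg θ.2.1]
      exact mul_le_of_le_one_right (norm_nonneg _) θ.2.2)

theorem volterra_apply (h : C(unitInterval, E)) (θ : unitInterval) :
    volterra E h θ = ∫ r in (0 : ℝ)..θ, IccExtend zero_le_one h r := rfl

/-- A curve in `C([0,1], E)` solving the integral form of `γ' = s • g γ` follows the flow. -/
theorem flow_eq_of_integral_eq [CompleteSpace E] {g : E → E} {K : NNReal} (hg : LipschitzWith K g)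
    {φ : E → ℝ → E} (hφ0 : ∀ p, φ p 0 = p) (hφ : ∀ p t, HasDerivAt (φ p) (g (φ p t)) t)
    {h k : C(unitInterval, E)} {p : E} {s : ℝ}
    (hk : ∀ θ, k θ = g (h θ))
    (hh : ∀ θ, h θ = p + s • volterra E k θ) :
    φ p s = h 1 := by
  have hkc : Continuous (IccExtend zero_le_one k) := k.continuous.Icc_extend' (h := zero_le_one)
  set η : ℝ → E := fun x => p + s • ∫ r in (0 : ℝ)..x, IccExtend zero_le_one k r with hη
  have hηd (x : ℝ) : HasDerivAt η (s • IccExtend zero_le_one k x) x :=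
    ((intervalIntegral.integral_hasDerivAt_right (hkc.intervalIntegrable _ _)
      (hkc.stronglyMeasurableAtFilter _ _) hkc.continuousAt).const_smul s).const_add p
  have hηh (x : ℝ) (hx : x ∈ Icc (0 : ℝ) 1) : η x = h ⟨x, hx⟩ := by
    rw [hh, volterra_apply]
  have hηg (x : ℝ) (hx : x ∈ Icc (0 : ℝ) 1) : IccExtend zero_le_one k x = g (η x) := by
    rw [IccExtend_of_mem _ _ hx, hk, hηh x hx]
  have hsg : LipschitzWith (‖s‖₊ * K) fun y => s • g y := by
    refine LipschitzWith.of_dist_le_mul fun y z => ?_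
    rw [dist_smul₀]
    push_cast
    rw [mul_assoc]
    gcongr
    exact hg.dist_le_mul y z
  have huniq : EqOn η (fun x => φ p (s * x)) (Icc 0 1) := by
    refine ODE_solution_unique (v := fun _ y => s • g y) (K := ‖s‖₊ * K) (fun _ => hsg)
      (fun x _ => (hηd x).continuousAt.continuousWithinAt) ?_
      (fun x _ => ?_) ?_ ?_
    · intro x hx
      have := (hηd x).hasDerivWithinAt (s := Ici x)
      rwa [hηg x (Ico_subset_Icc_self hx)] at this
    · exact ((hφ p (s * x)).continuousAt.comp
        (continuousAt_const.mul continuousAt_id)).continuousWithinAt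
    · intro x _
      have h1 : HasDerivAt (fun x : ℝ => s * x) s x := by
        simpa using (hasDerivAt_id x).const_mul s
      exact ((hφ p (s * x)).scomp x h1).hasDerivWithinAt
    · simp [hη, hφ0]
  have h1 := huniq (right_mem_Icc.2 zero_le_one)
  simp only [mul_one] at h1
  rw [← h1, hηh 1 (right_mem_Icc.2 zero_le_one)]
  rfl

open scoped ContDiff in
/-- The flow of a Lipschitz vector field is jointly analytic at `(q, 0)` if the field is analytic
at `q`. -/
theorem analyticAt_flow_zero [CompleteSpace E] {g : E → E} {K : NNReal} (hg : LipschitzWith K g)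
    {φ : E → ℝ → E} (hφ0 : ∀ p, φ p 0 = p) (hφ : ∀ p t, HasDerivAt (φ p) (g (φ p t)) t)
    {q : E} (hq : AnalyticAt ℝ g q) :
    AnalyticAt ℝ (Function.uncurry φ) (q, 0) := by
  obtain ⟨N, hN, hNg⟩ := hq.exists_analyticAt_comp_continuousMap (K := unitInterval)
  set q' : C(unitInterval, E) := ContinuousMap.const unitInterval q with hq'
  let cst : E →L[ℝ] C(unitInterval, E) :=
    LinearMap.mkContinuous
      { toFun := fun p => ContinuousMap.const unitInterval p
        map_add' := fun _ _ => rfl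
        map_smul' := fun _ _ => rfl } 1 (fun p =>
          (ContinuousMap.norm_le _ (by positivity)).2 fun θ => (one_mul ‖p‖).ge)
  have hcst (p : E) (θ : unitInterval) : cst p θ = p := rfl
  let Ψ : (E × ℝ) × C(unitInterval, E) → C(unitInterval, E) :=
    fun w => w.2 - cst w.1.1 - w.1.2 • volterra E (N w.2)
  let u : (E × ℝ) × C(unitInterval, E) := ((q, 0), q')
  have hN2 : AnalyticAt ℝ (fun w : (E × ℝ) × C(unitInterval, E) => N w.2) u :=
    AnalyticAt.comp (g := N) (f := Prod.snd) hN analyticAt_snd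
  have hVN : AnalyticAt ℝ (fun w : (E × ℝ) × C(unitInterval, E) => volterra E (N w.2)) u :=
    ((volterra E).analyticAt _).comp hN2
  have hΨ : AnalyticAt ℝ Ψ u := by
    refine AnalyticAt.sub (AnalyticAt.sub analyticAt_snd ?_) (AnalyticAt.fun_smul ?_ hVN)
    · exact (cst.analyticAt _).comp (analyticAt_fst.comp analyticAt_fst)
    · exact analyticAt_snd.comp analyticAt_fst
  have hΨ0 : Ψ u = 0 := by
    ext θ
    simp [Ψ, u, hq', hcst]
  have hfd : fderiv ℝ Ψ u ∘L .inr ℝ (E × ℝ) C(unitInterval, E)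
      = ContinuousLinearMap.id ℝ C(unitInterval, E) := by
    have h1 : HasFDerivAt (fun h : C(unitInterval, E) => Ψ ((q, 0), h))
        (fderiv ℝ Ψ u ∘L .inr ℝ (E × ℝ) C(unitInterval, E)) q' :=
      hΨ.differentiableAt.hasFDerivAt.comp q' (hasFDerivAt_prodMk_right (q, (0 : ℝ)) q')
    have h2 : HasFDerivAt (fun h : C(unitInterval, E) => Ψ ((q, 0), h))
        (ContinuousLinearMap.id ℝ C(unitInterval, E)) q' := by
      simpa [Ψ] using (hasFDerivAt_id q').sub_const (cst q)
    exact h1.unique h2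
  have hinv : (fderiv ℝ Ψ u ∘L .inr ℝ (E × ℝ) C(unitInterval, E)).IsInvertible := by
    rw [hfd]; exact ⟨ContinuousLinearEquiv.refl ℝ _, rfl⟩
  have cd : ContDiffAt ℝ ω Ψ u := hΨ.contDiffAt
  set f := cd.implicitFunction (by simp) hinv with hf
  have hfan : AnalyticAt ℝ f (q, 0) := (cd.contDiffAt_implicitFunction (by simp) hinv).analyticAt
  have hf0 : f (q, 0) = q' := cd.implicitFunction_apply_self (by simp) hinv
  have hev := cd.eventually_apply_implicitFunction (by simp) hinv
  have hNev : ∀ᶠ w in nhds ((q, 0) : E × ℝ), ∀ θ, N (f w) θ = g (f w θ) := by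
    have : Tendsto f (nhds (q, 0)) (nhds q') := by
      rw [← hf0]; exact hfan.continuousAt
    exact this.eventually hNg
  have heq : Function.uncurry φ =ᶠ[nhds (q, 0)]
      fun w => ContinuousMap.evalCLM ℝ (1 : unitInterval) (f w) := by
    filter_upwards [hev, hNev] with w h1 h2
    rw [hΨ0] at h1
    refine flow_eq_of_integral_eq hg hφ0 hφ (h := f w) (k := N (f w)) h2 fun θ => ?_
    have h3 := congrArg (fun F : C(unitInterval, E) => F θ) h1
    rw [← sub_eq_zero, ← sub_sub]
    exact h3
  exact (((ContinuousMap.evalCLM ℝ (1 : unitInterval) :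
    C(unitInterval, E) →L[ℝ] E).analyticAt _).comp hfan).congr heq.symm

theorem flow_add {g : E → E} {K : NNReal} (hg : LipschitzWith K g)
    {φ : E → ℝ → E} (hφ0 : ∀ p, φ p 0 = p) (hφ : ∀ p t, HasDerivAt (φ p) (g (φ p t)) t)
    (p : E) (s t : ℝ) : φ p (s + t) = φ (φ p s) t := by
  refine congrFun (ODE_solution_unique_univ (v := fun _ => g) (s := fun _ => univ) (K := K)
    (f := fun t => φ p (s + t)) (g := φ (φ p s)) (t₀ := 0)
    (fun _ => hg.lipschitzOnWith) (fun t => ⟨?_, trivial⟩) (fun t => ⟨hφ _ t, trivial⟩)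
    (by simp [hφ0])) t
  exact (hφ p (s + t)).comp_const_add s t

/-- The flow of a Lipschitz vector field is jointly analytic at `(p, s)` if the field is analytic
along the trajectory of `p` between the times `0` and `s`. -/
theorem analyticAt_flow [CompleteSpace E] {g : E → E} {K : NNReal} (hg : LipschitzWith K g)
    {φ : E → ℝ → E} (hφ0 : ∀ p, φ p 0 = p) (hφ : ∀ p t, HasDerivAt (φ p) (g (φ p t)) t)
    {p : E} {s : ℝ} (hp : ∀ τ ∈ uIcc 0 s, AnalyticAt ℝ g (φ p τ)) :
    AnalyticAt ℝ (Function.uncurry φ) (p, s) := by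
  have key : ∀ x ∈ uIcc 0 s, ∀ᶠ y in nhdsWithin x (uIcc 0 s),
      (AnalyticAt ℝ (Function.uncurry φ) (p, x) ↔ AnalyticAt ℝ (Function.uncurry φ) (p, y)) := by
    intro x hx
    have hloc := (analyticAt_flow_zero hg hφ0 hφ (hp x hx)).eventually_analyticAt
    have hcont : ContinuousAt (φ p) x := (hφ p x).continuousAt
    have step : ∀ a b : ℝ, AnalyticAt ℝ (Function.uncurry φ) (φ p a, b - a) →
        AnalyticAt ℝ (Function.uncurry φ) (p, a) → AnalyticAt ℝ (Function.uncurry φ) (p, b) := by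
      intro a b h1 h2
      have h3 : Function.uncurry φ = fun w : E × ℝ =>
          Function.uncurry φ (Function.uncurry φ (w.1, w.2 - (b - a)), b - a) := by
        ext w
        simp only [Function.uncurry]
        rw [← flow_add hg hφ0 hφ]
        congr 1; ring
      rw [h3]
      have h4 : AnalyticAt ℝ (fun w : E × ℝ => Function.uncurry φ (w.1, w.2 - (b - a))) (p, b) := by
        refine AnalyticAt.fun_comp (g := Function.uncurry φ) (f := fun w : E × ℝ =>
          (w.1, w.2 - (b - a))) ?_
          (analyticAt_fst.prod (analyticAt_snd.sub analyticAt_const))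
        simpa using h2
      refine AnalyticAt.fun_comp (g := Function.uncurry φ) (f := fun w : E × ℝ =>
          (Function.uncurry φ (w.1, w.2 - (b - a)), b - a)) ?_ (h4.prod analyticAt_const)
      simpa [Function.uncurry] using h1
    have e1 : ∀ᶠ y in nhds x, AnalyticAt ℝ (Function.uncurry φ) (φ p x, y - x) := by
      have : ContinuousAt (fun y => (φ p x, y - x)) x := by fun_prop
      exact this.eventually (by simpa using hloc)
    have e2 : ∀ᶠ y in nhds x, AnalyticAt ℝ (Function.uncurry φ) (φ p y, x - y) := by
      have : ContinuousAt (fun y => (φ p y, x - y)) x := by fun_prop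
      exact this.eventually (by simpa using hloc)
    refine (e1.and e2).filter_mono nhdsWithin_le_nhds |>.mono fun y hy => ?_
    exact ⟨step x y hy.1, step y x hy.2⟩
  have h0 : AnalyticAt ℝ (Function.uncurry φ) (p, 0) := by
    have := hp 0 left_mem_uIcc
    rw [hφ0] at this
    exact analyticAt_flow_zero hg hφ0 hφ this
  exact (isPreconnected_uIcc.induction₂
    (fun x y => AnalyticAt ℝ (Function.uncurry φ) (p, x) ↔ AnalyticAt ℝ (Function.uncurry φ) (p, y))
    key (fun _ _ _ _ _ _ => Iff.trans) (fun _ _ _ _ => Iff.symm)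
    left_mem_uIcc right_mem_uIcc).1 h0

/-- A bounded Lipschitz vector field on a Banach space has a globally defined flow. -/
theorem exists_flow_of_lipschitzWith [CompleteSpace E] {g : E → E} {K L : NNReal}
    (hg : LipschitzWith K g) (hL : ∀ x, ‖g x‖ ≤ L) :
    ∃ φ : E → ℝ → E, (∀ p, φ p 0 = p) ∧ ∀ p t, HasDerivAt (φ p) (g (φ p t)) t := by
  have hex (p : E) : ∃ γ : ℝ → E, γ 0 = p ∧ ∀ t, HasDerivAt γ (g (γ t)) t := by
    have hN (n : ℕ) : ∃ α : ℝ → E, α 0 = p ∧ ∀ t ∈ Ioo (-(n + 1 : ℝ)) (n + 1),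
        HasDerivAt α (g (α t)) t := by
      have h0 : (0 : ℝ) ∈ Icc (-(n + 1 : ℝ)) (n + 1) := ⟨by linarith, by positivity⟩
      obtain ⟨α, hα0, hα⟩ := (IsPicardLindelof.of_time_independent (f := g)
        (t₀ := (⟨0, h0⟩ : Icc (-(n + 1 : ℝ)) (n + 1))) (x₀ := p) (a := L * (n + 1)) (r := 0)
        (L := L) (K := K) (fun x _ => hL x) hg.lipschitzOnWith (by simp))
        |>.exists_eq_forall_mem_Icc_hasDerivWithinAt₀
      exact ⟨α, hα0, fun t ht => (hα t (Ioo_subset_Icc_self ht)).hasDerivAt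
        (Icc_mem_nhds ht.1 ht.2)⟩
    choose α hα0 hα using hN
    have hagree (m n : ℕ) (hmn : m ≤ n) : EqOn (α m) (α n) (Ioo (-(m + 1 : ℝ)) (m + 1)) := by
      have hmn' : (m : ℝ) ≤ n := by exact_mod_cast hmn
      refine ODE_solution_unique_of_mem_Ioo (v := fun _ => g) (s := fun _ => univ) (K := K)
        (t₀ := 0) (fun _ _ => hg.lipschitzOnWith) ⟨by linarith, by positivity⟩
        (fun t ht => ⟨hα m t ht, trivial⟩)
        (fun t ht => ⟨hα n t ⟨by linarith [ht.1], by linarith [ht.2]⟩, trivial⟩)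
        (by rw [hα0, hα0])
    refine ⟨fun t => α ⌈|t|⌉₊ t, by simp [hα0], fun t => ?_⟩
    set n := ⌈|t|⌉₊ + 1 with hn
    have htn : |t| < (n : ℝ) := by
      have := Nat.le_ceil |t|
      push_cast [hn]; linarith
    have hev : (fun t => α ⌈|t|⌉₊ t) =ᶠ[nhds t] α n := by
      have : ∀ᶠ s in nhds t, |s| < (n : ℝ) := (continuous_abs.tendsto t).eventually_lt_const htn
      filter_upwards [this] with s hs
      refine hagree _ _ (Nat.ceil_le.2 hs.le) ?_
      have h1 := Nat.le_ceil |s|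
      exact ⟨by linarith [neg_abs_le s], by linarith [le_abs_self s]⟩
    have := hα n t ⟨by linarith [neg_abs_le t], by linarith [le_abs_self t]⟩
    rw [← hev.eq_of_nhds] at this
    exact this.congr_of_eventuallyEq hev
  choose φ h0 h1 using hex
  exact ⟨φ, h0, h1⟩

end Flow

/-- A solution of `f' = k f` is its initial value times the exponential of `∫ k`. -/
theorem eq_mul_exp_integral_of_hasDerivAt {f k : ℝ → ℝ} (hk : Continuous k)
    (hf : ∀ s, HasDerivAt f (k s * f s) s) (s : ℝ) :
    f s = f 0 * Real.exp (∫ r in (0 : ℝ)..s, k r) := by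
  have hI (x : ℝ) : HasDerivAt (fun x => ∫ r in (0 : ℝ)..x, k r) (k x) x :=
    intervalIntegral.integral_hasDerivAt_right (hk.intervalIntegrable _ _)
      (hk.stronglyMeasurableAtFilter _ _) hk.continuousAt
  have hd (x : ℝ) : HasDerivAt (fun x => f x * Real.exp (-∫ r in (0 : ℝ)..x, k r)) 0 x := by
    refine ((hf x).mul (hI x).fun_neg.exp).congr_deriv ?_
    ring
  have h := is_const_of_deriv_eq_zero (fun x => (hd x).differentiableAt) (fun x => (hd x).deriv) s 0
  simp only [intervalIntegral.integral_same, neg_zero, Real.exp_zero, mul_one] at h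
  rw [← h, mul_assoc, ← Real.exp_add, neg_add_cancel, Real.exp_zero, mul_one]

/-- If `f > 0`, `f' = k f` and `|k + l| ≤ D'` on `[0, L]`, then the variation of
`log f + l s` is at most that of `D`. -/
theorem abs_log_add_sub_le_of_hasDerivAt {f k D D' : ℝ → ℝ} {l L : ℝ} (hL : 0 ≤ L)
    (hf : ∀ s ∈ Icc 0 L, HasDerivAt f (k s * f s) s) (hpos : ∀ s ∈ Icc 0 L, 0 < f s)
    (hD : ∀ s, HasDerivAt D (D' s) s) (hk : ∀ s ∈ Icc 0 L, |k s + l| ≤ D' s) :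
    |Real.log (f L) + l * L - Real.log (f 0)| ≤ D L - D 0 := by
  have hg (s : ℝ) (hs : s ∈ Icc 0 L) :
      HasDerivAt (fun s => Real.log (f s) + l * s - Real.log (f 0)) (k s + l) s := by
    refine ((((hf s hs).log (hpos s hs).ne').add ((hasDerivAt_id s).const_mul l)).sub_const
      _).congr_deriv ?_
    rw [mul_div_cancel_right₀ _ (hpos s hs).ne', mul_one]
  have h0L : L ∈ Icc 0 L := right_mem_Icc.2 hL
  rw [abs_le]
  constructor
  · have := image_le_of_deriv_right_le_deriv_boundary
      (f := fun s => -(D s - D 0)) (f' := fun s => -D' s)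
      (B := fun s => Real.log (f s) + l * s - Real.log (f 0)) (B' := fun s => k s + l)
      (a := 0) (b := L)
      (fun s _ => ((hD s).sub_const _).fun_neg.continuousAt.continuousWithinAt)
      (fun s _ => ((hD s).sub_const _).fun_neg.hasDerivWithinAt) (by simp)
      (fun s hs => (hg s hs).continuousAt.continuousWithinAt)
      (fun s hs => (hg s (Ico_subset_Icc_self hs)).hasDerivWithinAt)
      (fun s hs => (abs_le.1 (hk s (Ico_subset_Icc_self hs))).1) h0L
    exact this
  · exact image_le_of_deriv_right_le_deriv_boundary
      (f' := fun s => k s + l)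
      (f := fun s => Real.log (f s) + l * s - Real.log (f 0)) (B' := D')
      (B := fun s => D s - D 0) (a := 0) (b := L)
      (fun s hs => (hg s hs).continuousAt.continuousWithinAt)
      (fun s hs => (hg s (Ico_subset_Icc_self hs)).hasDerivWithinAt) (by simp)
      (fun s _ => ((hD s).sub_const _).continuousAt.continuousWithinAt)
      (fun s _ => ((hD s).sub_const _).hasDerivWithinAt)
      (fun s hs => (abs_le.1 (hk s (Ico_subset_Icc_self hs))).2) h0L

theorem isCompact_Bcyl : IsCompact Bcyl := by
  refine IsCompact.of_isClosed_subset
    (isCompact_Icc (a := ((0, 0, 0) : ℝ × ℝ × ℝ)) (b := (1, 1, 1))) ?_ ?_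
  · have : Bcyl = {p | 0 ≤ p.1} ∩ {p | p.1 ≤ 1} ∩ {p | 0 ≤ p.2.1} ∩ {p | 0 ≤ p.2.2}
        ∩ {p | p.2.1 ^ 2 + p.2.2 ^ 2 ≤ 1} := by
      ext p; simp [Bcyl, and_assoc]
    rw [this]
    refine ((((isClosed_le ?_ ?_).inter (isClosed_le ?_ ?_)).inter (isClosed_le ?_ ?_)).inter
      (isClosed_le ?_ ?_)).inter (isClosed_le ?_ ?_) <;> fun_prop
  · rintro ⟨x, y, z⟩ ⟨h1, h2, h3, h4, h5⟩
    simp only at h1 h2 h3 h4 h5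
    exact ⟨⟨h1, h3, h4⟩, h2, by nlinarith, by nlinarith⟩

/-- `φ` is the flow of the field `χ • (x, β y, γ z)`, where `χ` is a cutoff function of `Bcyl`. -/
structure IsSaddleFlow (β γ χ : ℝ × ℝ × ℝ → ℝ) (φ : ℝ × ℝ × ℝ → ℝ → ℝ × ℝ × ℝ) : Prop where
  continuous_chi : Continuous χ
  continuous_beta : Continuous fun p => χ p * β p
  continuous_gamma : Continuous fun p => χ p * γ p
  chi_nonneg : ∀ p, 0 ≤ χ p
  chi_le_one : ∀ p, χ p ≤ 1
  chi_eq_one : ∀ p ∈ Bcyl, χ p = 1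
  map_zero : ∀ p, φ p 0 = p
  hasDerivAt : ∀ p t, HasDerivAt (φ p)
    (χ (φ p t) • ((φ p t).1, β (φ p t) * (φ p t).2.1, γ (φ p t) * (φ p t).2.2)) t

namespace IsSaddleFlow

variable {β γ χ : ℝ × ℝ × ℝ → ℝ} {φ : ℝ × ℝ × ℝ → ℝ → ℝ × ℝ × ℝ}

theorem continuous (h : IsSaddleFlow β γ χ φ) (p : ℝ × ℝ × ℝ) : Continuous (φ p) :=
  continuous_iff_continuousAt.2 fun t => (h.hasDerivAt p t).continuousAt

theorem hasDerivAt_x (h : IsSaddleFlow β γ χ φ) (p : ℝ × ℝ × ℝ) (t : ℝ) :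
    HasDerivAt (fun t => (φ p t).1) (χ (φ p t) * (φ p t).1) t :=
  (h.hasDerivAt p t).fst

theorem hasDerivAt_y (h : IsSaddleFlow β γ χ φ) (p : ℝ × ℝ × ℝ) (t : ℝ) :
    HasDerivAt (fun t => (φ p t).2.1) (χ (φ p t) * β (φ p t) * (φ p t).2.1) t := by
  have : HasDerivAt (fun t => (φ p t).2.1) (χ (φ p t) * (β (φ p t) * (φ p t).2.1)) t :=
    (h.hasDerivAt p t).snd.fst
  rwa [← mul_assoc] at this

theorem hasDerivAt_z (h : IsSaddleFlow β γ χ φ) (p : ℝ × ℝ × ℝ) (t : ℝ) :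
    HasDerivAt (fun t => (φ p t).2.2) (χ (φ p t) * γ (φ p t) * (φ p t).2.2) t := by
  have : HasDerivAt (fun t => (φ p t).2.2) (χ (φ p t) * (γ (φ p t) * (φ p t).2.2)) t :=
    (h.hasDerivAt p t).snd.snd
  rwa [← mul_assoc] at this

theorem x_eq (h : IsSaddleFlow β γ χ φ) (p : ℝ × ℝ × ℝ) (t : ℝ) :
    (φ p t).1 = p.1 * Real.exp (∫ r in (0 : ℝ)..t, χ (φ p r)) := by
  have := eq_mul_exp_integral_of_hasDerivAt (h.continuous_chi.comp (h.continuous p))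
    (h.hasDerivAt_x p) t
  simpa [h.map_zero] using this

theorem y_pos (h : IsSaddleFlow β γ χ φ) {p : ℝ × ℝ × ℝ} (hp : 0 < p.2.1) (t : ℝ) :
    0 < (φ p t).2.1 := by
  have := eq_mul_exp_integral_of_hasDerivAt (h.continuous_beta.comp (h.continuous p))
    (h.hasDerivAt_y p) t
  simp only [h.map_zero] at this
  rw [this]; positivity

theorem z_pos (h : IsSaddleFlow β γ χ φ) {p : ℝ × ℝ × ℝ} (hp : 0 < p.2.2) (t : ℝ) :
    0 < (φ p t).2.2 := by
  have := eq_mul_exp_integral_of_hasDerivAt (h.continuous_gamma.comp (h.continuous p))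
    (h.hasDerivAt_z p) t
  simp only [h.map_zero] at this
  rw [this]; positivity

/-- Trajectories entering through the cylindrical side stay in `Bcyl` until `x = 1`. -/
theorem mem_Bcyl (h : IsSaddleFlow β γ χ φ)
    (htrans : ∀ p ∈ Bcyl, (p.2.1, p.2.2) ≠ ((0 : ℝ), (0 : ℝ)) →
      β p * p.2.1 ^ 2 + γ p * p.2.2 ^ 2 < 0)
    {p : ℝ × ℝ × ℝ} (hx : 0 < p.1) (hy : 0 < p.2.1) (hz : 0 < p.2.2)
    (hr : p.2.1 ^ 2 + p.2.2 ^ 2 = 1) {t : ℝ} (ht : t ∈ Icc 0 (-Real.log p.1)) :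
    φ p t ∈ Bcyl := by
  have hxpos (s : ℝ) : 0 < (φ p s).1 := by rw [h.x_eq]; positivity
  have hxle (s : ℝ) (hs : s ∈ Icc 0 (-Real.log p.1)) : (φ p s).1 ≤ 1 := by
    have hint : ∫ r in (0 : ℝ)..s, χ (φ p r) ≤ ∫ r in (0 : ℝ)..s, (1 : ℝ) :=
      intervalIntegral.integral_mono_on hs.1
        ((h.continuous_chi.comp (h.continuous p)).intervalIntegrable _ _)
        (continuous_const.intervalIntegrable _ _) fun r _ => h.chi_le_one _
    simp only [intervalIntegral.integral_const, sub_zero, smul_eq_mul, mul_one] at hint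
    rw [h.x_eq]
    calc p.1 * Real.exp (∫ r in (0 : ℝ)..s, χ (φ p r)) ≤ p.1 * Real.exp (-Real.log p.1) := by
          gcongr; exact hint.trans hs.2
      _ = 1 := by rw [Real.exp_neg, Real.exp_log hx, mul_inv_cancel₀ hx.ne']
  have hd (s : ℝ) : HasDerivAt (fun s => (φ p s).2.1 ^ 2 + (φ p s).2.2 ^ 2)
      (2 * χ (φ p s) * (β (φ p s) * (φ p s).2.1 ^ 2 + γ (φ p s) * (φ p s).2.2 ^ 2)) s := by
    refine (((h.hasDerivAt_y p s).fun_pow 2).add ((h.hasDerivAt_z p s).fun_pow 2)).congr_deriv ?_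
    push_cast
    ring
  have hle := image_le_of_deriv_right_lt_deriv_boundary' (a := 0) (b := -Real.log p.1)
    (f := fun s => (φ p s).2.1 ^ 2 + (φ p s).2.2 ^ 2) (B := fun _ => 1) (B' := fun _ => 0)
    (fun s _ => (hd s).continuousAt.continuousWithinAt) (fun s _ => (hd s).hasDerivWithinAt)
    (by simp [h.map_zero, hr]) continuousOn_const (fun s _ => hasDerivWithinAt_const _ _ _)
    (by
      intro s hs hs1
      have hmem : φ p s ∈ Bcyl := ⟨(hxpos s).le, hxle s (Ico_subset_Icc_self hs),
        (h.y_pos hy s).le, (h.z_pos hz s).le, hs1.le⟩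
      have := htrans _ hmem (by
        rw [Ne, Prod.mk.injEq, not_and_or]
        exact Or.inl (h.y_pos hy s).ne')
      rw [h.chi_eq_one _ hmem]
      linarith)
  exact ⟨(hxpos t).le, hxle t ht, (h.y_pos hy t).le, (h.z_pos hz t).le, hle ht⟩

theorem x_eq_mul_exp (h : IsSaddleFlow β γ χ φ) {p : ℝ × ℝ × ℝ} {T t : ℝ}
    (hB : ∀ s ∈ Icc 0 T, φ p s ∈ Bcyl) (ht : t ∈ Icc 0 T) :
    (φ p t).1 = p.1 * Real.exp t := by
  have : ∫ r in (0 : ℝ)..t, χ (φ p r) = ∫ r in (0 : ℝ)..t, (1 : ℝ) := by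
    refine intervalIntegral.integral_congr fun r hr => ?_
    rw [uIcc_of_le ht.1] at hr
    exact h.chi_eq_one _ (hB r ⟨hr.1, hr.2.trans ht.2⟩)
  rw [h.x_eq, this]
  simp

/-- Uniform estimates for the transition from the cylindrical side to the section `x = 1`. -/
theorem abs_log_transition_le (h : IsSaddleFlow β γ χ φ) {lam mu κ M C : ℝ}
    (hκ : 0 < κ) (hM : 0 ≤ M) (hC : 0 ≤ C)
    (hβ : ∀ p ∈ Bcyl, |β p + lam| ≤ C * (p.1 + p.2.1 + p.2.2))
    (hγ : ∀ p ∈ Bcyl, |γ p + mu| ≤ C * (p.1 + p.2.1 + p.2.2))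
    (hQ : ∀ p ∈ Bcyl, β p * p.2.1 ^ 2 + γ p * p.2.2 ^ 2
      ≤ (-κ + M * p.1) * (p.2.1 ^ 2 + p.2.2 ^ 2))
    {p : ℝ × ℝ × ℝ} (hx : 0 < p.1) (hx1 : p.1 ≤ 1) (hy : 0 < p.2.1) (hz : 0 < p.2.2)
    (hB : ∀ s ∈ Icc 0 (-Real.log p.1), φ p s ∈ Bcyl) :
    |Real.log (φ p (-Real.log p.1)).2.1 + lam * (-Real.log p.1) - Real.log p.2.1|
        ≤ C * (1 + 2 * Real.exp M / κ) ∧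
    |Real.log (φ p (-Real.log p.1)).2.2 + mu * (-Real.log p.1) - Real.log p.2.2|
        ≤ C * (1 + 2 * Real.exp M / κ) := by
  set L := -Real.log p.1 with hL
  have hL0 : 0 ≤ L := by
    have := Real.log_nonpos hx.le hx1
    linarith
  have hexpL : p.1 * Real.exp L = 1 := by
    rw [hL, Real.exp_neg, Real.exp_log hx, mul_inv_cancel₀ hx.ne']
  have hxe (s : ℝ) (hs : s ∈ Icc 0 L) : (φ p s).1 = p.1 * Real.exp s := h.x_eq_mul_exp hB hs
  set W : ℝ → ℝ := fun s => Real.exp (2 * κ * s - 2 * M * (p.1 * Real.exp s)) with hW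
  have hWd (s : ℝ) : HasDerivAt W (W s * (2 * κ - 2 * M * (p.1 * Real.exp s))) s := by
    refine ((((hasDerivAt_id s).const_mul (2 * κ)).sub
      (((Real.hasDerivAt_exp s).const_mul p.1).const_mul (2 * M))).exp).congr_deriv ?_
    simp [hW]
  have hrd (s : ℝ) : HasDerivAt (fun s => ((φ p s).2.1 ^ 2 + (φ p s).2.2 ^ 2) * W s)
      (2 * χ (φ p s) * (β (φ p s) * (φ p s).2.1 ^ 2 + γ (φ p s) * (φ p s).2.2 ^ 2) * W s
        + ((φ p s).2.1 ^ 2 + (φ p s).2.2 ^ 2) *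
          (W s * (2 * κ - 2 * M * (p.1 * Real.exp s)))) s := by
    refine ((((h.hasDerivAt_y p s).fun_pow 2).add
      ((h.hasDerivAt_z p s).fun_pow 2)).mul (hWd s)).congr_deriv ?_
    simp only [Pi.add_apply]
    push_cast
    ring
  have hr0 : p.2.1 ^ 2 + p.2.2 ^ 2 ≤ 1 := by
    have := (hB 0 ⟨le_rfl, hL0⟩).2.2.2.2
    rwa [h.map_zero] at this
  have hrW (s : ℝ) (hs : s ∈ Icc 0 L) : ((φ p s).2.1 ^ 2 + (φ p s).2.2 ^ 2) * W s ≤ 1 := by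
    refine image_le_of_deriv_right_le_deriv_boundary (a := 0) (b := L)
      (f := fun s => ((φ p s).2.1 ^ 2 + (φ p s).2.2 ^ 2) * W s) (B := fun _ => 1)
      (B' := fun _ => 0)
      (fun s _ => (hrd s).continuousAt.continuousWithinAt) (fun s _ => (hrd s).hasDerivWithinAt)
      ?_ continuousOn_const (fun s _ => hasDerivWithinAt_const _ _ _) ?_ hs
    · simp only [h.map_zero]
      refine mul_le_one₀ hr0 (Real.exp_pos _).le ?_
      rw [hW, Real.exp_le_one_iff]
      have : 0 ≤ M * p.1 := by positivity
      simp only [mul_zero, Real.exp_zero, mul_one]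
      linarith
    · intro s hs
      have hs' := Ico_subset_Icc_self hs
      have hq := hQ _ (hB s hs')
      rw [hxe s hs'] at hq
      rw [h.chi_eq_one _ (hB s hs')]
      have hWpos : 0 < W s := Real.exp_pos _
      nlinarith [mul_le_mul_of_nonneg_right hq hWpos.le]
  have hr (s : ℝ) (hs : s ∈ Icc 0 L) :
      (φ p s).2.1 ^ 2 + (φ p s).2.2 ^ 2 ≤ (Real.exp M * Real.exp (-κ * s)) ^ 2 := by
    have h1 : p.1 * Real.exp s ≤ 1 := by
      rw [← hexpL]; gcongr; exact hs.2
    have h2 : (Real.exp M * Real.exp (-κ * s)) ^ 2 * W s ≥ 1 := by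
      rw [← Real.exp_add, ← Real.exp_nat_mul, hW, ← Real.exp_add, ge_iff_le, Real.one_le_exp_iff]
      push_cast
      nlinarith
    have h3 := (hrW s hs).trans h2
    exact le_of_mul_le_mul_right h3 (Real.exp_pos _)
  have hyb (s : ℝ) (hs : s ∈ Icc 0 L) : (φ p s).2.1 ≤ Real.exp M * Real.exp (-κ * s) :=
    le_of_abs_le (abs_le_of_sq_le_sq (by nlinarith [hr s hs, sq_nonneg (φ p s).2.2])
      (by positivity))
  have hzb (s : ℝ) (hs : s ∈ Icc 0 L) : (φ p s).2.2 ≤ Real.exp M * Real.exp (-κ * s) :=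
    le_of_abs_le (abs_le_of_sq_le_sq (by nlinarith [hr s hs, sq_nonneg (φ p s).2.1])
      (by positivity))
  set D : ℝ → ℝ := fun s => C * (p.1 * Real.exp s - 2 * Real.exp M / κ * Real.exp (-κ * s)) with hD
  set D' : ℝ → ℝ := fun s => C * (p.1 * Real.exp s + 2 * (Real.exp M * Real.exp (-κ * s))) with hD'
  have hDd (s : ℝ) : HasDerivAt D (D' s) s := by
    have h1 : HasDerivAt (fun s => Real.exp (-κ * s)) (Real.exp (-κ * s) * (-κ * 1)) s :=
      ((hasDerivAt_id s).const_mul (-κ)).exp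
    refine ((((Real.hasDerivAt_exp s).const_mul p.1).sub
      (h1.const_mul (2 * Real.exp M / κ))).const_mul C).congr_deriv ?_
    simp only [hD']
    field_simp
    ring
  have hsum (s : ℝ) (hs : s ∈ Icc 0 L) :
      C * ((φ p s).1 + (φ p s).2.1 + (φ p s).2.2) ≤ D' s := by
    simp only [hD']
    rw [hxe s hs]
    gcongr C * ?_
    linarith [hyb s hs, hzb s hs]
  have hDL : D L - D 0 ≤ C * (1 + 2 * Real.exp M / κ) := by
    simp only [hD, hexpL, ← mul_sub, mul_zero, Real.exp_zero, mul_one]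
    gcongr C * ?_
    have : 0 ≤ 2 * Real.exp M / κ * Real.exp (-κ * L) := by positivity
    linarith
  constructor
  · have := abs_log_add_sub_le_of_hasDerivAt (l := lam) hL0
      (fun s _ => h.hasDerivAt_y p s) (fun s _ => h.y_pos hy s) hDd (fun s hs => by
        rw [h.chi_eq_one _ (hB s hs), one_mul]
        exact (hβ _ (hB s hs)).trans (hsum s hs))
    rw [h.map_zero] at this
    exact this.trans hDL
  · have := abs_log_add_sub_le_of_hasDerivAt (l := mu) hL0
      (fun s _ => h.hasDerivAt_z p s) (fun s _ => h.z_pos hz s) hDd (fun s hs => by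
        rw [h.chi_eq_one _ (hB s hs), one_mul]
        exact (hγ _ (hB s hs)).trans (hsum s hs))
    rw [h.map_zero] at this
    exact this.trans hDL

end IsSaddleFlow

/-- Uniform contraction towards the `x`-axis, with an error controlled by `x`. -/
theorem exists_uniform_contraction {β γ : ℝ × ℝ × ℝ → ℝ} {lam mu C : ℝ}
    (hlam : 0 < lam) (hmu : 0 < mu) (hC : 0 ≤ C)
    (hβc : ContinuousOn β Bcyl) (hγc : ContinuousOn γ Bcyl)
    (hβ : ∀ p ∈ Bcyl, |β p + lam| ≤ C * (p.1 + p.2.1 + p.2.2))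
    (hγ : ∀ p ∈ Bcyl, |γ p + mu| ≤ C * (p.1 + p.2.1 + p.2.2))
    (htrans : ∀ p ∈ Bcyl, (p.2.1, p.2.2) ≠ ((0 : ℝ), (0 : ℝ)) →
      β p * p.2.1 ^ 2 + γ p * p.2.2 ^ 2 < 0) :
    ∃ κ : ℝ, 0 < κ ∧ ∀ p ∈ Bcyl, β p * p.2.1 ^ 2 + γ p * p.2.2 ^ 2
      ≤ (-κ + C * p.1) * (p.2.1 ^ 2 + p.2.2 ^ 2) := by
  set m := min lam mu with hm
  have hm0 : 0 < m := lt_min hlam hmu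
  set ε := m / (4 * (C + 1)) with hε
  have hε0 : 0 < ε := by positivity
  have hCε : C * (2 * ε) ≤ m / 2 := by
    have : (C + 1) * ε = m / 4 := by rw [hε]; field_simp
    nlinarith
  have hcomp : IsCompact (Bcyl ∩ {p | ε ^ 2 ≤ p.2.1 ^ 2 + p.2.2 ^ 2}) :=
    isCompact_Bcyl.inter_right (isClosed_le (by fun_prop) (by fun_prop))
  obtain ⟨κ', hκ', hκle⟩ := hcomp.exists_forall_le' (a := 0)
    (f := fun p => -(β p * p.2.1 ^ 2 + γ p * p.2.2 ^ 2))
    (((hβc.mul (by fun_prop)).add (hγc.mul (by fun_prop))).neg.mono inter_subset_left)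
    (by
      rintro p ⟨hp, hpε⟩
      have := htrans p hp (by
        rintro h0
        rw [Prod.mk.injEq] at h0
        rw [mem_ofPred_eq, h0.1, h0.2] at hpε
        nlinarith [sq_nonneg ε, pow_pos hε0 2])
      linarith)
  refine ⟨min κ' (m / 2), lt_min hκ' (by positivity), fun p hp => ?_⟩
  have hp' := hp
  obtain ⟨hx, -, hy, hz, hr⟩ := hp'
  rcases le_or_gt (ε ^ 2) (p.2.1 ^ 2 + p.2.2 ^ 2) with h | h
  · have h1 := hκle p ⟨hp, h⟩
    have h2 : min κ' (m / 2) * (p.2.1 ^ 2 + p.2.2 ^ 2) ≤ κ' * 1 :=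
      mul_le_mul (min_le_left _ _) hr (by positivity) hκ'.le
    have h3 : 0 ≤ C * p.1 * (p.2.1 ^ 2 + p.2.2 ^ 2) := by positivity
    linarith
  · have hyε : p.2.1 ≤ ε :=
      le_of_abs_le (abs_le_of_sq_le_sq (by nlinarith [sq_nonneg p.2.2]) hε0.le)
    have hzε : p.2.2 ≤ ε :=
      le_of_abs_le (abs_le_of_sq_le_sq (by nlinarith [sq_nonneg p.2.1]) hε0.le)
    have hs : C * (p.1 + p.2.1 + p.2.2) ≤ C * p.1 + m / 2 := by
      have : C * (p.2.1 + p.2.2) ≤ C * (2 * ε) := by gcongr; linarith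
      linarith
    have hmin := min_le_right κ' (m / 2)
    have hb : β p ≤ -min κ' (m / 2) + C * p.1 := by
      have := (abs_le.1 (hβ p hp)).2
      linarith [min_le_left lam mu]
    have hc : γ p ≤ -min κ' (m / 2) + C * p.1 := by
      have := (abs_le.1 (hγ p hp)).2
      linarith [min_le_right lam mu]
    rw [mul_add]
    gcongr

section Cutoff

variable {E F : Type*} [NormedAddCommGroup E] [NormedSpace ℝ E]
  [NormedAddCommGroup F] [NormedSpace ℝ F] [CompleteSpace F]

theorem contDiff_cutoff_smul {V : Set E} {χ : E → ℝ} {G : E → F} (hχ : ContDiff ℝ 1 χ)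
    (hs : tsupport χ ⊆ V) (hG : AnalyticOnNhd ℝ G V) : ContDiff ℝ 1 fun x => χ x • G x :=
  contDiff_iff_contDiffAt.2 fun x => by
    by_cases hx : x ∈ tsupport χ
    · exact hχ.contDiffAt.smul (hG x (hs hx)).contDiffAt
    · refine (contDiffAt_const (c := (0 : F))).congr_of_eventuallyEq ?_
      filter_upwards [(isClosed_tsupport χ).isOpen_compl.mem_nhds hx] with y hy
      simp [image_eq_zero_of_notMem_tsupport hy]

open scoped Manifold ContDiff in
theorem exists_contDiff_cutoff [FiniteDimensional ℝ E] {V B : Set E} (hV : IsOpen V)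
    (hB : IsCompact B) (hBV : B ⊆ V) :
    ∃ χ : E → ℝ, ContDiff ℝ 1 χ ∧ HasCompactSupport χ ∧ tsupport χ ⊆ V ∧
      (∀ x, χ x ∈ Icc 0 1) ∧ ∀ x ∈ B, χ =ᶠ[nhds x] fun _ => 1 := by
  obtain ⟨L, hL, hBL, hLV⟩ := exists_compact_between hB hV hBV
  obtain ⟨f, hf1, hf0, hf⟩ := exists_contMDiffMap_one_nhds_of_subset_interior (n := 1) 𝓘(ℝ, E)
    hB.isClosed hBL
  have hsub : tsupport f ⊆ L := closure_minimal
    (fun x hx => by_contra fun h => hx (hf0 x h)) hL.isClosed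
  exact ⟨f, f.contMDiff.contDiff, hL.of_isClosed_subset (isClosed_tsupport _) hsub,
    hsub.trans hLV, hf, fun x hx => hf1.filter_mono (nhds_le_nhdsSet hx)⟩

theorem exists_lipschitzWith_cutoff_smul {V : Set E} {χ : E → ℝ} {G : E → F}
    (hχ : ContDiff ℝ 1 χ) (hc : HasCompactSupport χ) (hs : tsupport χ ⊆ V)
    (hG : AnalyticOnNhd ℝ G V) :
    (∃ K, LipschitzWith K fun x => χ x • G x) ∧ ∃ L : NNReal, ∀ x, ‖χ x • G x‖ ≤ L := by
  have h1 := contDiff_cutoff_smul hχ hs hG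
  have h2 : HasCompactSupport fun x => χ x • G x := hc.smul_right
  refine ⟨h1.lipschitzWith_of_hasCompactSupport h2 one_ne_zero, ?_⟩
  obtain ⟨C, hC⟩ := h1.continuous.bounded_above_of_compact_support h2
  exact ⟨C.toNNReal, fun x => (hC x).trans (Real.le_coe_toNNReal C)⟩

end Cutoff

/-- Reparameterization of a Lipschitz curve by a time change whose speed is a positive function of
the position. -/
theorem exists_time_change {E : Type*} [PseudoMetricSpace E] {η : ℝ → E} {α : E → ℝ}
    {K₁ K₂ A : NNReal} {κ : ℝ}
    (hη : LipschitzWith K₁ η) (hα : LipschitzWith K₂ α) (hκ : 0 < κ)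
    (hακ : ∀ p, κ ≤ α p) (hαA : ∀ p, ‖α p‖ ≤ A) {T : ℝ} (hT : 0 ≤ T) :
    ∃ θ : ℝ → ℝ, ∃ S : ℝ, 0 ≤ S ∧ θ 0 = 0 ∧ θ S = T ∧ (∀ s, HasDerivAt θ (α (η (θ s))) s) ∧
      ∀ s ∈ Icc 0 S, θ s ∈ Icc 0 T := by
  obtain ⟨φ, hφ0, hφ⟩ := exists_flow_of_lipschitzWith (g := fun r => α (η r)) (hα.comp hη)
    (fun r => hαA (η r))
  have hmono : Monotone (φ 0) := monotone_of_hasDerivAt_nonneg (hφ 0)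
    fun s => hκ.le.trans (hακ _)
  have hcont : Continuous (φ 0) := continuous_iff_continuousAt.2 fun s => (hφ 0 s).continuousAt
  have hgrow : κ * (T / κ) ≤ φ 0 (T / κ) := by
    refine image_le_of_deriv_right_le_deriv_boundary (a := 0) (b := T / κ)
      (f := fun s => κ * s) (f' := fun _ => κ) (by fun_prop)
      (fun s _ => by simpa using ((hasDerivAt_id s).const_mul κ).hasDerivWithinAt)
      (by simp [hφ0]) hcont.continuousOn (fun s _ => (hφ 0 s).hasDerivWithinAt)
      (fun s _ => hακ _) (right_mem_Icc.2 (by positivity))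
  rw [mul_div_cancel₀ _ hκ.ne'] at hgrow
  obtain ⟨S, hS, hST⟩ := intermediate_value_Icc (a := 0) (b := T / κ) (by positivity)
    hcont.continuousOn ⟨(hφ0 0).le.trans hT, hgrow⟩
  refine ⟨φ 0, S, hS.1, hφ0 0, hST, hφ 0, fun s hs => ⟨?_, hST ▸ hmono hs.2⟩⟩
  have := hmono hs.1
  rwa [hφ0] at this

namespace IsSaddleFlow

variable {β γ χ : ℝ × ℝ × ℝ → ℝ} {φ : ℝ × ℝ × ℝ → ℝ → ℝ × ℝ × ℝ}

/-- An integral curve in `Bcyl` of a positive multiple of `(x, β y, γ z)` is a reparameterization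
of a trajectory of the saddle flow, the new time being `log x`. -/
theorem eq_of_integralCurve (h : IsSaddleFlow β γ χ φ) {K A : NNReal}
    (hK : LipschitzWith K fun p : ℝ × ℝ × ℝ => χ p • (p.1, β p * p.2.1, γ p * p.2.2))
    {α : ℝ × ℝ × ℝ → ℝ} (hα : ∀ p ∈ Bcyl, 0 < α p) (hA : ∀ p ∈ Bcyl, α p ≤ A)
    {ζ : ℝ → ℝ × ℝ × ℝ} {s₀ s₁ : ℝ} (hB : ∀ τ ∈ Icc s₀ s₁, ζ τ ∈ Bcyl)
    (hζ : ∀ τ ∈ Icc s₀ s₁, HasDerivAt ζ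
      (α (ζ τ) • ((ζ τ).1, β (ζ τ) * (ζ τ).2.1, γ (ζ τ) * (ζ τ).2.2)) τ)
    (hx : 0 < (ζ s₀).1) {τ : ℝ} (hτ : τ ∈ Icc s₀ s₁) :
    ζ τ = φ (ζ s₀) (Real.log (ζ τ).1 - Real.log (ζ s₀).1) := by
  have hxd (s : ℝ) (hs : s ∈ Icc s₀ s₁) :
      HasDerivAt (fun s => (ζ s).1) (α (ζ s) * (ζ s).1) s := (hζ s hs).fst
  have hcont : ContinuousOn ζ (Icc s₀ s₁) := fun s hs => (hζ s hs).continuousAt.continuousWithinAt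
  have hxge (s : ℝ) (hs : s ∈ Icc s₀ s₁) : (ζ s₀).1 ≤ (ζ s).1 :=
    image_le_of_deriv_right_le_deriv_boundary (f := fun _ => (ζ s₀).1) (f' := fun _ => 0)
      continuousOn_const (fun _ _ => hasDerivWithinAt_const _ _ _) le_rfl
      (fun s hs => (hxd s hs).continuousAt.continuousWithinAt)
      (fun s hs => (hxd s (Ico_subset_Icc_self hs)).hasDerivWithinAt)
      (fun s hs => mul_nonneg (hα _ (hB s (Ico_subset_Icc_self hs))).le
        (hB s (Ico_subset_Icc_self hs)).1) hs
  set σ : ℝ → ℝ := fun s => Real.log (ζ s).1 - Real.log (ζ s₀).1 with hσ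
  have hσd (s : ℝ) (hs : s ∈ Icc s₀ s₁) : HasDerivAt σ (α (ζ s)) s := by
    have hpos := hx.trans_le (hxge s hs)
    refine (((hxd s hs).log hpos.ne').sub_const _).congr_deriv ?_
    rw [mul_div_cancel_right₀ _ hpos.ne']
  refine ODE_solution_unique_of_mem_Icc_right
    (v := fun s p => α (ζ s) • χ p • (p.1, β p * p.2.1, γ p * p.2.2)) (s := fun _ => univ)
    (K := A * K) (f := ζ) (g := fun s => φ (ζ s₀) (σ s)) ?_ hcont ?_ (fun _ _ => trivial)
    ?_ ?_ (fun _ _ => trivial) (by simp [hσ, h.map_zero]) hτ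
  · intro s hs
    have hmem := hB s (Ico_subset_Icc_self hs)
    refine (LipschitzWith.of_dist_le_mul fun p q => ?_).lipschitzOnWith
    rw [dist_smul₀, Real.norm_of_nonneg (hα _ hmem).le]
    push_cast
    rw [mul_assoc]
    exact mul_le_mul (hA _ hmem) (hK.dist_le_mul p q) dist_nonneg A.2
  · intro s hs
    have hs' := Ico_subset_Icc_self hs
    have := (hζ s hs').hasDerivWithinAt (s := Ici s)
    rw [h.chi_eq_one _ (hB s hs'), one_smul]
    exact this
  · exact fun s hs => ((h.continuous _).continuousAt.comp
      (hσd s hs).continuousAt).continuousWithinAt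
  · intro s hs
    exact ((h.hasDerivAt (ζ s₀) (σ s)).scomp s (hσd s (Ico_subset_Icc_self hs))).hasDerivWithinAt

/-- A trajectory of the saddle flow in `Bcyl` can be reparameterized to an integral curve of a
positive multiple of `(x, β y, γ z)`. -/
theorem exists_integralCurve (h : IsSaddleFlow β γ χ φ) {L K₂ A : NNReal}
    (hL : ∀ p : ℝ × ℝ × ℝ, ‖χ p • (p.1, β p * p.2.1, γ p * p.2.2)‖ ≤ L)
    {α : ℝ × ℝ × ℝ → ℝ} {κ : ℝ} (hα : LipschitzWith K₂ α) (hκ : 0 < κ)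
    (hακ : ∀ p, κ ≤ α p) (hαA : ∀ p, ‖α p‖ ≤ A) {p : ℝ × ℝ × ℝ} {T : ℝ} (hT : 0 ≤ T)
    (hB : ∀ s ∈ Icc 0 T, φ p s ∈ Bcyl) :
    ∃ ζ : ℝ → ℝ × ℝ × ℝ, ∃ S : ℝ, 0 ≤ S ∧ ζ 0 = p ∧ ζ S = φ p T ∧
      (∀ s ∈ Icc 0 S, ζ s ∈ Bcyl) ∧ ∀ s ∈ Icc 0 S, HasDerivAt ζ
        (α (ζ s) • ((ζ s).1, β (ζ s) * (ζ s).2.1, γ (ζ s) * (ζ s).2.2)) s := by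
  have hη : LipschitzWith L (φ p) := lipschitzWith_of_nnnorm_deriv_le
    (fun t => (h.hasDerivAt p t).differentiableAt)
    (fun t => by rw [(h.hasDerivAt p t).deriv]; exact hL _)
  obtain ⟨θ, S, hS, hθ0, hθS, hθ, hmem⟩ := exists_time_change hη hα hκ hακ hαA hT
  refine ⟨fun s => φ p (θ s), S, hS, by simp [hθ0, h.map_zero], by simp [hθS],
    fun s hs => hB _ (hmem s hs), fun s hs => ?_⟩
  have := (h.hasDerivAt p (θ s)).scomp s (hθ s)
  rwa [h.chi_eq_one _ (hB _ (hmem s hs)), one_smul] at this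

end IsSaddleFlow

theorem CurveHasWeight.exists_abs_log_sub_le {c : ℝ → ℝ × ℝ} {ρ : ℝ} (h : CurveHasWeight c ρ)
    (hc : ∀ t ∈ Ici (1 : ℝ), 0 < (c t).1 ∧ 0 < (c t).2) :
    ∃ R : ℝ, ∀ᶠ t in atTop, |Real.log (c t).2 - ρ * Real.log (c t).1| ≤ R := by
  obtain ⟨k₁, k₂, t₀, hk₁, hk, ht₀, h⟩ := h
  refine ⟨max |Real.log k₁| |Real.log k₂|, ?_⟩
  filter_upwards [eventually_gt_atTop t₀] with t ht
  obtain ⟨hu, hv⟩ := hc t (ht₀.trans ht).le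
  obtain ⟨h1, h2⟩ := h t ht
  have hpow : 0 < (c t).1 ^ ρ := Real.rpow_pos_of_pos hu ρ
  have h1' := Real.log_le_log (by positivity) h1.le
  have h2' := Real.log_le_log hv h2.le
  rw [Real.log_mul hk₁.ne' hpow.ne', Real.log_rpow hu] at h1'
  rw [Real.log_mul (hk₁.trans hk).ne' hpow.ne', Real.log_rpow hu] at h2'
  rw [abs_le]
  constructor
  · have := neg_abs_le (Real.log k₁)
    have := le_max_left |Real.log k₁| |Real.log k₂|
    linarith
  · have := le_abs_self (Real.log k₂)
    have := le_max_right |Real.log k₁| |Real.log k₂|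
    linarith

theorem CurveHasWeight.of_abs_log_sub_le {c : ℝ → ℝ × ℝ} {ρ R : ℝ}
    (hc : ∀ t ∈ Ici (1 : ℝ), 0 < (c t).1 ∧ 0 < (c t).2)
    (h : ∀ᶠ t in atTop, |Real.log (c t).2 - ρ * Real.log (c t).1| ≤ R) :
    CurveHasWeight c ρ := by
  obtain ⟨t₀, ht₀⟩ := eventually_atTop.1 h
  have hR : 0 ≤ R := (abs_nonneg _).trans (ht₀ t₀ le_rfl)
  refine ⟨Real.exp (-R - 1), Real.exp (R + 1), max t₀ 2, Real.exp_pos _,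
    Real.exp_lt_exp.2 (by linarith), by simp, fun t ht => ?_⟩
  have ht1 : (1 : ℝ) < t := by linarith [le_max_right t₀ 2]
  obtain ⟨hu, hv⟩ := hc t ht1.le
  have habs := abs_le.1 (ht₀ t ((le_max_left t₀ 2).trans ht.le))
  rw [Real.rpow_def_of_pos hu, ← Real.exp_add, ← Real.exp_add, ← Real.lt_log_iff_exp_lt hv,
    ← Real.log_lt_iff_lt_exp hv]
  constructor <;> linarith

theorem fencePhiBar_pos {q : ℝ × ℝ} (hq : q ∈ Ioo (0 : ℝ) 1 ×ˢ Ioo (0 : ℝ) 1) :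
    0 < (fencePhiBar q).2.1 ∧ 0 < (fencePhiBar q).2.2 := by
  obtain ⟨⟨h0, h1⟩, -⟩ := hq
  have := Real.pi_pos
  exact ⟨Real.sin_pos_of_pos_of_lt_pi (by positivity) (by nlinarith),
    Real.cos_pos_of_mem_Ioo ⟨by nlinarith, by nlinarith⟩⟩

theorem sq_add_sq_fencePhiBar (q : ℝ × ℝ) :
    (fencePhiBar q).2.1 ^ 2 + (fencePhiBar q).2.2 ^ 2 = 1 := Real.sin_sq_add_cos_sq _

theorem analyticAt_fencePhiBar (q : ℝ × ℝ) : AnalyticAt ℝ fencePhiBar q := by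
  have hw : AnalyticAt ℝ (fun q : ℝ × ℝ => Real.pi * q.1 / 2) q :=
    (analyticAt_const.mul analyticAt_fst).div_const
  exact analyticAt_snd.prod ((Real.analyticAt_sin.comp hw).prod (Real.analyticAt_cos.comp hw))

theorem deriv_eq_zero_of_deriv_fencePhiBar {c : ℝ → ℝ × ℝ} {t : ℝ} (hc : DifferentiableAt ℝ c t)
    (h : deriv (fun s => fencePhiBar (c s)) t = 0) : deriv c t = 0 := by
  have hu' : HasDerivAt (fun s => (c s).1) (deriv c t).1 t := hc.hasDerivAt.fst
  have hv' : HasDerivAt (fun s => (c s).2) (deriv c t).2 t := hc.hasDerivAt.snd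
  have hw : HasDerivAt (fun s => Real.pi * (c s).1 / 2) (Real.pi * (deriv c t).1 / 2) t :=
    (hu'.const_mul Real.pi).div_const 2
  have hP := hv'.prodMk (hw.sin.prodMk hw.cos)
  change HasDerivAt (fun s => fencePhiBar (c s)) _ t at hP
  rw [hP.deriv] at h
  simp only [Prod.mk_eq_zero] at h
  obtain ⟨hv, hs, hk⟩ := h
  have hu : Real.pi * (deriv c t).1 / 2 = 0 := by
    have := Real.sin_sq_add_cos_sq (Real.pi * (c t).1 / 2)
    linear_combination (Real.cos (Real.pi * (c t).1 / 2)) * hs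
      - (Real.sin (Real.pi * (c t).1 / 2)) * hk - (Real.pi * (deriv c t).1 / 2) * this
  have hpi := Real.pi_pos.ne'
  refine Prod.ext ?_ hv
  simpa [hpi] using hu

theorem abs_log_sin_sub_le {u : ℝ} (h0 : 0 < u) (h1 : u ≤ 1) :
    |Real.log (Real.sin (Real.pi * u / 2)) - Real.log u| ≤ Real.log (Real.pi / 2) := by
  have hpi := Real.pi_gt_three
  have hle : u ≤ Real.sin (Real.pi * u / 2) := by
    have := Real.mul_le_sin (x := Real.pi * u / 2) (by positivity) (by nlinarith)
    convert this using 1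
    field_simp
  have hge : Real.sin (Real.pi * u / 2) ≤ Real.pi / 2 * u := by
    have := Real.sin_le (x := Real.pi * u / 2) (by positivity)
    linarith
  have h2 := Real.log_le_log h0 hle
  have h3 := Real.log_le_log (h0.trans_le hle) hge
  rw [Real.log_mul (by positivity) h0.ne'] at h3
  rw [abs_le]
  constructor
  · have := Real.log_nonneg (x := Real.pi / 2) (by linarith)
    linarith
  · linarith

theorem abs_log_cos_le {u : ℝ} (h0 : 0 ≤ u) (h1 : u ≤ 1 / 2) :
    |Real.log (Real.cos (Real.pi * u / 2))| ≤ Real.log 2 := by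
  have hpi := Real.pi_gt_three
  have hge : 1 / 2 ≤ Real.cos (Real.pi * u / 2) := by
    have := Real.one_sub_mul_le_cos (x := Real.pi * u / 2) (by positivity) (by nlinarith)
    have h2 : 2 / Real.pi * (Real.pi * u / 2) = u := by field_simp
    linarith
  have h2 := Real.log_le_log (by norm_num) hge
  have h3 := Real.log_nonpos (by linarith) (Real.cos_le_one (Real.pi * u / 2))
  rw [one_div, Real.log_inv] at h2
  rw [abs_le]
  constructor <;> linarith [Real.log_nonneg (x := 2) (by norm_num)]

/-- A logarithmic estimate `log y ≤ N + l log v` with `v → 0` forces `y → 0`. -/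
theorem tendsto_zero_of_log_le {y v : ℝ → ℝ} {l N : ℝ} (hl : 0 < l)
    (hy : ∀ᶠ t in atTop, 0 < y t) (hv : ∀ᶠ t in atTop, 0 < v t)
    (hv0 : Tendsto v atTop (nhds 0))
    (h : ∀ᶠ t in atTop, Real.log (y t) ≤ N + l * Real.log (v t)) :
    Tendsto y atTop (nhds 0) := by
  have hlog : Tendsto (fun t => N + l * Real.log (v t)) atTop atBot :=
    tendsto_atBot_add_const_left _ _ ((Real.tendsto_log_nhdsGT_zero.comp
      (tendsto_nhdsWithin_iff.2 ⟨hv0, hv⟩)).const_mul_atBot hl)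
  refine squeeze_zero' (hy.mono fun _ h => h.le) ?_ (Real.tendsto_exp_atBot.comp hlog)
  filter_upwards [hy, h] with t hyt ht
  exact (Real.log_le_iff_le_exp hyt).1 ht

namespace IsSaddleFlow

variable {β γ χ : ℝ × ℝ × ℝ → ℝ} {φ : ℝ × ℝ × ℝ → ℝ → ℝ × ℝ × ℝ}

/-- The transition map from the cylindrical side to the section `x = 1` is an immersion. -/
theorem deriv_eq_zero_of_deriv_transition (h : IsSaddleFlow β γ χ φ) {K : NNReal}
    (hK : LipschitzWith K fun p : ℝ × ℝ × ℝ => χ p • (p.1, β p * p.2.1, γ p * p.2.2))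
    (han : ∀ p ∈ Bcyl,
      AnalyticAt ℝ (fun p : ℝ × ℝ × ℝ => χ p • (p.1, β p * p.2.1, γ p * p.2.2)) p)
    (htrans : ∀ p ∈ Bcyl, (p.2.1, p.2.2) ≠ ((0 : ℝ), (0 : ℝ)) →
      β p * p.2.1 ^ 2 + γ p * p.2.2 ^ 2 < 0)
    {P : ℝ → ℝ × ℝ × ℝ} {t : ℝ} (hP : DifferentiableAt ℝ P t) (hx : 0 < (P t).1)
    (hx1 : (P t).1 ≤ 1) (hr : ∀ s, (P s).2.1 ^ 2 + (P s).2.2 ^ 2 = 1)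
    (hB : ∀ s ∈ Icc 0 (-Real.log (P t).1), φ (P t) s ∈ Bcyl)
    (hone : ∀ᶠ s in nhds t, (φ (P s) (-Real.log (P s).1)).1 = 1)
    (hd : DifferentiableAt ℝ (fun s => (φ (P s) (-Real.log (P s).1)).2) t)
    (hd0 : deriv (fun s => (φ (P s) (-Real.log (P s).1)).2) t = 0) :
    deriv P t = 0 := by
  set d := fun s => (φ (P s) (-Real.log (P s).1)).2 with hd_def
  have hL0 : 0 ≤ -Real.log (P t).1 := by
    have := Real.log_nonpos hx.le hx1
    linarith
  have hPt : P t ∈ Bcyl := by simpa [h.map_zero] using hB 0 ⟨le_rfl, hL0⟩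
  have hback (s : ℝ) (hs : (φ (P s) (-Real.log (P s).1)).1 = 1) (r : ℝ) :
      φ (1, d s) r = φ (P s) (-Real.log (P s).1 + r) := by
    rw [flow_add hK h.map_zero h.hasDerivAt, hd_def, ← hs]
  have hPd : HasDerivAt P (deriv P t) t := hP.hasDerivAt
  have hPx : HasDerivAt (fun s => (P s).1) (deriv P t).1 t := hPd.fst
  have hPy : HasDerivAt (fun s => (P s).2.1) (deriv P t).2.1 t := hPd.snd.fst
  have hPz : HasDerivAt (fun s => (P s).2.2) (deriv P t).2.2 t := hPd.snd.snd
  have hanal : AnalyticAt ℝ (Function.uncurry φ) ((1, d t), Real.log (P t).1) := by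
    refine analyticAt_flow hK h.map_zero h.hasDerivAt fun τ hτ => han _ ?_
    rw [hback t hone.self_of_nhds]
    rw [uIcc_of_ge (by linarith)] at hτ
    exact hB _ ⟨by linarith [hτ.1], by linarith [hτ.2]⟩
  have hcurve : HasDerivAt (fun s => (((1 : ℝ), d s), Real.log (P s).1))
      ((0, 0), (deriv P t).1 / (P t).1) t :=
    ((hasDerivAt_const t (1 : ℝ)).prodMk (hd0 ▸ hd.hasDerivAt)).prodMk (hPx.log hx.ne')
  have htime : HasDerivAt (fun r => (((1 : ℝ), d t), r)) ((0, 0), 1) (Real.log (P t).1) :=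
    (hasDerivAt_const _ _).prodMk (hasDerivAt_id _)
  have h1 := hanal.differentiableAt.hasFDerivAt.comp_hasDerivAt t hcurve
  have h2 := hanal.differentiableAt.hasFDerivAt.comp_hasDerivAt (Real.log (P t).1) htime
  have h3 := (h.hasDerivAt (1, d t) (Real.log (P t).1)).unique h2
  rw [hback t hone.self_of_nhds, neg_add_cancel, h.map_zero, h.chi_eq_one _ hPt, one_smul] at h3
  have hPeq : (Function.uncurry φ ∘ fun s => (((1 : ℝ), d s), Real.log (P s).1)) =ᶠ[nhds t] P := by
    filter_upwards [hone] with s hs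
    simp only [Function.comp, Function.uncurry_apply_pair]
    rw [hback s hs, neg_add_cancel, h.map_zero]
  set w := (deriv P t).1 / (P t).1 with hw
  have hsmul : (((0 : ℝ), (0 : ℝ × ℝ)), w) = w • (((0 : ℝ), (0 : ℝ × ℝ)), (1 : ℝ)) := by
    simp
  have hPG : deriv P t = w • ((P t).1, β (P t) * (P t).2.1, γ (P t) * (P t).2.2) := by
    rw [h3, ← map_smul]
    refine (hPd.congr_of_eventuallyEq hPeq).unique (h1.congr_deriv ?_)
    exact congrArg _ hsmul
  have hcircle : (P t).2.1 * (deriv P t).2.1 + (P t).2.2 * (deriv P t).2.2 = 0 := by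
    have hdc := (hPy.fun_pow 2).add (hPz.fun_pow 2)
    have := hdc.unique ((hasDerivAt_const t (1 : ℝ)).congr_of_eventuallyEq
      (Eventually.of_forall fun s => hr s))
    norm_num at this
    linarith
  have hQ := htrans (P t) hPt (by
    intro h0
    rw [Prod.mk.injEq] at h0
    have := hr t
    rw [h0.1, h0.2] at this
    norm_num at this)
  have hw0 : w = 0 := by
    have hy : (deriv P t).2.1 = w * (β (P t) * (P t).2.1) := by rw [hPG]; rfl
    have hz : (deriv P t).2.2 = w * (γ (P t) * (P t).2.2) := by rw [hPG]; rfl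
    rw [hy, hz] at hcircle
    have : w * (β (P t) * (P t).2.1 ^ 2 + γ (P t) * (P t).2.2 ^ 2) = 0 := by
      linear_combination hcircle
    exact (mul_eq_zero.1 this).resolve_right hQ.ne
  rw [hPG, hw0, zero_smul]

end IsSaddleFlow

theorem neg_log_nonneg {v : ℝ} (hv : v ∈ Ioo (0 : ℝ) 1) : 0 ≤ -Real.log v :=
  neg_nonneg.2 (Real.log_nonpos hv.1.le hv.2.le)

namespace IsSaddleFlow

variable {β γ χ : ℝ × ℝ × ℝ → ℝ} {φ : ℝ × ℝ × ℝ → ℝ → ℝ × ℝ × ℝ}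

theorem mem_Bcyl_fencePhiBar (h : IsSaddleFlow β γ χ φ)
    (htrans : ∀ p ∈ Bcyl, (p.2.1, p.2.2) ≠ ((0 : ℝ), (0 : ℝ)) →
      β p * p.2.1 ^ 2 + γ p * p.2.2 ^ 2 < 0)
    {q : ℝ × ℝ} (hq : q ∈ Ioo (0 : ℝ) 1 ×ˢ Ioo (0 : ℝ) 1) :
    ∀ s ∈ Icc 0 (-Real.log q.2), φ (fencePhiBar q) s ∈ Bcyl := fun _ hs =>
  h.mem_Bcyl htrans hq.2.1 (fencePhiBar_pos hq).1 (fencePhiBar_pos hq).2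
    (sq_add_sq_fencePhiBar q) hs

theorem fst_transition_eq_one (h : IsSaddleFlow β γ χ φ)
    (htrans : ∀ p ∈ Bcyl, (p.2.1, p.2.2) ≠ ((0 : ℝ), (0 : ℝ)) →
      β p * p.2.1 ^ 2 + γ p * p.2.2 ^ 2 < 0)
    {q : ℝ × ℝ} (hq : q ∈ Ioo (0 : ℝ) 1 ×ˢ Ioo (0 : ℝ) 1) :
    (φ (fencePhiBar q) (-Real.log q.2)).1 = 1 := by
  rw [h.x_eq_mul_exp (h.mem_Bcyl_fencePhiBar htrans hq) ⟨neg_log_nonneg hq.2, le_rfl⟩,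
    Real.exp_neg, Real.exp_log hq.2.1]
  exact mul_inv_cancel₀ hq.2.1.ne'

/-- The transition from the cylindrical side to the section `x = 1` maps a curve of weight `ρ` to
a curve of weight `μρ / (1 + λρ)`. -/
theorem weight_transition (h : IsSaddleFlow β γ χ φ) {K : NNReal}
    (hK : LipschitzWith K fun p : ℝ × ℝ × ℝ => χ p • (p.1, β p * p.2.1, γ p * p.2.2))
    (han : ∀ p ∈ Bcyl,
      AnalyticAt ℝ (fun p : ℝ × ℝ × ℝ => χ p • (p.1, β p * p.2.1, γ p * p.2.2)) p)
    (htrans : ∀ p ∈ Bcyl, (p.2.1, p.2.2) ≠ ((0 : ℝ), (0 : ℝ)) →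
      β p * p.2.1 ^ 2 + γ p * p.2.2 ^ 2 < 0)
    {lam mu C : ℝ} (hlam : 0 < lam) (hmu : 0 < mu) (hC : 0 ≤ C)
    (hβc : ContinuousOn β Bcyl) (hγc : ContinuousOn γ Bcyl)
    (hβ : ∀ p ∈ Bcyl, |β p + lam| ≤ C * (p.1 + p.2.1 + p.2.2))
    (hγ : ∀ p ∈ Bcyl, |γ p + mu| ≤ C * (p.1 + p.2.1 + p.2.2))
    {c : ℝ → ℝ × ℝ} {ρ : ℝ} (hρ : 0 < ρ) (hc : WeightCurve c) (hcw : CurveHasWeight c ρ)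
    (hsq : ∀ t ∈ Ici (1 : ℝ), c t ∈ Ioo (0 : ℝ) 1 ×ˢ Ioo (0 : ℝ) 1) :
    WeightCurve (fun t => (φ (fencePhiBar (c t)) (-Real.log (c t).2)).2) ∧
      CurveHasWeight (fun t => (φ (fencePhiBar (c t)) (-Real.log (c t).2)).2)
        (mu * ρ / (1 + lam * ρ)) := by
  obtain ⟨hca, hcpos, hcd, hclim⟩ := hc
  obtain ⟨κ, hκ, hQ⟩ := exists_uniform_contraction hlam hmu hC hβc hγc hβ hγ htrans
  set d : ℝ → ℝ × ℝ := fun t => (φ (fencePhiBar (c t)) (-Real.log (c t).2)).2 with hd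
  have hv0 (t : ℝ) (ht : t ∈ Ici (1 : ℝ)) : 0 < (c t).2 := (hcpos t ht).2
  have hv1 (t : ℝ) (ht : t ∈ Ici (1 : ℝ)) : (c t).2 < 1 := (hsq t ht).2.2
  have hB (t : ℝ) (ht : t ∈ Ici (1 : ℝ)) := h.mem_Bcyl_fencePhiBar htrans (hsq t ht)
  have hdpos (t : ℝ) (ht : t ∈ Ici (1 : ℝ)) : 0 < (d t).1 ∧ 0 < (d t).2 :=
    ⟨h.y_pos (fencePhiBar_pos (hsq t ht)).1 _, h.z_pos (fencePhiBar_pos (hsq t ht)).2 _⟩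
  have hda : AnalyticOnNhd ℝ d (Ici 1) := by
    intro t ht
    have hflow : AnalyticAt ℝ (Function.uncurry φ) (fencePhiBar (c t), -Real.log (c t).2) := by
      refine analyticAt_flow hK h.map_zero h.hasDerivAt fun τ hτ => han _ (hB t ht τ ?_)
      rwa [uIcc_of_le (neg_log_nonneg (hsq t ht).2)] at hτ
    have hcv : AnalyticAt ℝ (fun s => (c s).2) t := analyticAt_snd.comp (hca t ht)
    have hlog : AnalyticAt ℝ (fun s => -Real.log (c s).2) t := (hcv.log (hv0 t ht)).neg
    have harg : AnalyticAt ℝ (fun s => (fencePhiBar (c s), -Real.log (c s).2)) t :=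
      ((analyticAt_fencePhiBar (c t)).comp (hca t ht)).prod hlog
    exact analyticAt_snd.comp
      (AnalyticAt.comp_of_eq (g := Function.uncurry φ) hflow harg rfl)
  have hest (t : ℝ) (ht : t ∈ Ici (1 : ℝ)) := h.abs_log_transition_le hκ hC hC hβ hγ hQ
    (p := fencePhiBar (c t)) (hv0 t ht) (hv1 t ht).le (fencePhiBar_pos (hsq t ht)).1
    (fencePhiBar_pos (hsq t ht)).2 (hB t ht)
  set N := C * (1 + 2 * Real.exp C / κ) with hN
  have hY (t : ℝ) (ht : t ∈ Ici (1 : ℝ)) : |Real.log (d t).1 - lam * Real.log (c t).2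
      - Real.log (Real.sin (Real.pi * (c t).1 / 2))| ≤ N := by
    have := (hest t ht).1
    rwa [mul_neg, ← sub_eq_add_neg] at this
  have hZ (t : ℝ) (ht : t ∈ Ici (1 : ℝ)) : |Real.log (d t).2 - mu * Real.log (c t).2
      - Real.log (Real.cos (Real.pi * (c t).1 / 2))| ≤ N := by
    have := (hest t ht).2
    rwa [mul_neg, ← sub_eq_add_neg] at this
  have hu_lim : Tendsto (fun t => (c t).1) atTop (nhds 0) := (Prod.tendsto_iff _ _).1 hclim |>.1
  have hv_lim : Tendsto (fun t => (c t).2) atTop (nhds 0) := (Prod.tendsto_iff _ _).1 hclim |>.2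
  have hge : ∀ᶠ t : ℝ in atTop, t ∈ Ici (1 : ℝ) := eventually_ge_atTop 1
  refine ⟨⟨hda, hdpos, ?_, ?_⟩, ?_⟩
  · intro t ht hdt
    have ht' : t ∈ Ici (1 : ℝ) := ht.le
    have hcdiff : DifferentiableAt ℝ c t := (hca t ht').differentiableAt
    have hPd : DifferentiableAt ℝ (fun s => fencePhiBar (c s)) t :=
      ((analyticAt_fencePhiBar (c t)).comp (hca t ht')).differentiableAt
    refine hcd t ht (deriv_eq_zero_of_deriv_fencePhiBar hcdiff
      (h.deriv_eq_zero_of_deriv_transition hK han htrans hPd (hv0 t ht') (hv1 t ht').le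
        (fun s => sq_add_sq_fencePhiBar _) (hB t ht') ?_ (hda t ht').differentiableAt hdt))
    filter_upwards [Ioi_mem_nhds ht] with s hs
    exact h.fst_transition_eq_one htrans (hsq s (mem_Ici.2 (le_of_lt hs)))
  · refine Tendsto.prodMk_nhds (tendsto_zero_of_log_le (N := N) hlam
      (hge.mono fun t ht => (hdpos t ht).1) (hge.mono hv0) hv_lim ?_)
      (tendsto_zero_of_log_le (N := N) hmu (hge.mono fun t ht => (hdpos t ht).2)
      (hge.mono hv0) hv_lim ?_)
    · filter_upwards [hge] with t ht
      have h1 := (abs_le.1 (hY t ht)).2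
      have h2 : Real.log (Real.sin (Real.pi * (c t).1 / 2)) ≤ 0 :=
        Real.log_nonpos (fencePhiBar_pos (hsq t ht)).1.le (Real.sin_le_one _)
      change Real.log (d t).1 ≤ _
      linarith
    · filter_upwards [hge] with t ht
      have h1 := (abs_le.1 (hZ t ht)).2
      have h2 : Real.log (Real.cos (Real.pi * (c t).1 / 2)) ≤ 0 :=
        Real.log_nonpos (fencePhiBar_pos (hsq t ht)).2.le (Real.cos_le_one _)
      change Real.log (d t).2 ≤ _
      linarith
  · obtain ⟨R, hR⟩ := hcw.exists_abs_log_sub_le hcpos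
    set σ := mu * ρ / (1 + lam * ρ) with hσ
    have hσ0 : 0 < σ := by positivity
    have hσeq : σ * (1 + lam * ρ) = mu * ρ := by
      rw [hσ]; field_simp
    refine CurveHasWeight.of_abs_log_sub_le hdpos
      (R := N + Real.log 2 + mu * R + σ * N + σ * Real.log (Real.pi / 2) + σ * (lam * R)) ?_
    filter_upwards [hge, hR, hu_lim.eventually_le_const (show (0 : ℝ) < 1 / 2 by norm_num)]
      with t ht hRt hut
    have hs := abs_le.1 (abs_log_sin_sub_le (hsq t ht).1.1 (hsq t ht).1.2.le)
    have hk := abs_le.1 (abs_log_cos_le (hsq t ht).1.1.le hut)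
    have hYt := abs_le.1 (hY t ht)
    have hZt := abs_le.1 (hZ t ht)
    have hRt := abs_le.1 hRt
    rw [abs_le]
    constructor
    · nlinarith [mul_le_mul_of_nonneg_left hYt.2 hσ0.le, mul_le_mul_of_nonneg_left hs.2 hσ0.le,
        mul_le_mul_of_nonneg_left hRt.1 hmu.le,
        mul_le_mul_of_nonneg_left hRt.2 (mul_pos hσ0 hlam).le,
        congrArg (· * Real.log (c t).1) hσeq]
    · nlinarith [mul_le_mul_of_nonneg_left hYt.1 hσ0.le, mul_le_mul_of_nonneg_left hs.1 hσ0.le,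
        mul_le_mul_of_nonneg_left hRt.2 hmu.le,
        mul_le_mul_of_nonneg_left hRt.1 (mul_pos hσ0 hlam).le,
        congrArg (· * Real.log (c t).1) hσeq]

/-- The trace on the section `x = 1` of the saturation of a subset of the fence `Φ̄` is its image
under the transition map. -/
theorem setOf_phiX_mem_saturation (h : IsSaddleFlow β γ χ φ) {K L K₂ A : NNReal}
    (hK : LipschitzWith K fun p : ℝ × ℝ × ℝ => χ p • (p.1, β p * p.2.1, γ p * p.2.2))
    (hL : ∀ p : ℝ × ℝ × ℝ, ‖χ p • (p.1, β p * p.2.1, γ p * p.2.2)‖ ≤ L)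
    (htrans : ∀ p ∈ Bcyl, (p.2.1, p.2.2) ≠ ((0 : ℝ), (0 : ℝ)) →
      β p * p.2.1 ^ 2 + γ p * p.2.2 ^ 2 < 0)
    {α : ℝ × ℝ × ℝ → ℝ} {κ : ℝ} (hα : LipschitzWith K₂ α) (hκ : 0 < κ)
    (hακ : ∀ p, κ ≤ α p) (hαA : ∀ p, ‖α p‖ ≤ A) {ξ : ℝ × ℝ × ℝ → ℝ × ℝ × ℝ}
    (hξ : ∀ p ∈ Bcyl, ξ p = α p • (p.1, β p * p.2.1, γ p * p.2.2))
    {D : Set (ℝ × ℝ)} (hD : D ⊆ Ioo (0 : ℝ) 1 ×ˢ Ioo (0 : ℝ) 1) :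
    {q : ℝ × ℝ | 0 < q.1 ∧ 0 < q.2 ∧ phiX q ∈ Saturation ξ (fencePhiBar '' D)} =
      (fun q => (φ (fencePhiBar q) (-Real.log q.2)).2) '' D := by
  ext q
  constructor
  · rintro ⟨-, -, s₀, s₁, -, ζ, hB, hζ, ⟨s, hs, hsq⟩, hend⟩
    have hζ' (τ : ℝ) (hτ : τ ∈ Icc s₀ s₁) : HasDerivAt ζ
        (α (ζ τ) • ((ζ τ).1, β (ζ τ) * (ζ τ).2.1, γ (ζ τ) * (ζ τ).2.2)) τ :=
      hξ _ (hB τ hτ) ▸ hζ τ hτ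
    have hx1 : (ζ s).1 = 1 := by rw [hsq]; rfl
    rcases hend with ⟨r, hr, hrs⟩ | ⟨r, hr, hrs⟩
    · have hx0 : (ζ s₀).1 = r.2 := by rw [← hrs]; rfl
      have := h.eq_of_integralCurve hK (fun p _ => hκ.trans_le (hακ p))
        (fun p _ => (le_abs_self _).trans (hαA p)) hB hζ' (hx0 ▸ (hD hr).2.1) hs
      rw [hx1, hx0, Real.log_one, zero_sub, ← hrs, hsq] at this
      exact ⟨r, hr, by simp only [← this, phiX]⟩
    · have hx0 : (ζ s₁).1 = r.2 := by rw [← hrs]; rfl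
      have hxd (τ : ℝ) (hτ : τ ∈ Icc s₀ s₁) :
          HasDerivAt (fun τ => (ζ τ).1) (α (ζ τ) * (ζ τ).1) τ := (hζ' τ hτ).fst
      have hmono : MonotoneOn (fun τ => (ζ τ).1) (Icc s₀ s₁) :=
        monotoneOn_of_hasDerivWithinAt_nonneg (convex_Icc _ _)
          (fun τ hτ => (hxd τ hτ).continuousAt.continuousWithinAt)
          (fun τ hτ => (hxd τ (interior_subset hτ)).hasDerivWithinAt)
          (fun τ hτ => mul_nonneg (hκ.le.trans (hακ _)) (hB τ (interior_subset hτ)).1)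
      have := hmono hs (right_mem_Icc.2 (hs.1.trans hs.2)) hs.2
      simp only [hx1, hx0] at this
      exact absurd this (not_le.2 (hD hr).2.2)
  · rintro ⟨r, hr, rfl⟩
    have hq := hD hr
    obtain ⟨ζ, S, hS, hζ0, hζS, hB, hζ⟩ := h.exists_integralCurve hL hα hκ hακ hαA
      (neg_log_nonneg hq.2) (h.mem_Bcyl_fencePhiBar htrans hq)
    refine ⟨h.y_pos (fencePhiBar_pos hq).1 _, h.z_pos (fencePhiBar_pos hq).2 _, 0, S, hS, ζ, hB,
      fun τ hτ => hξ _ (hB τ hτ) ▸ hζ τ hτ, ⟨S, right_mem_Icc.2 hS, ?_⟩, Or.inl ⟨r, hr, hζ0.symm⟩⟩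
    rw [hζS]
    exact Prod.ext (h.fst_transition_eq_one htrans hq) rfl

end IsSaddleFlow

theorem abs_sub_le_of_lipschitzWith_Bcyl {f : ℝ × ℝ × ℝ → ℝ} {K : NNReal} (hf : LipschitzWith K f)
    {p : ℝ × ℝ × ℝ} (hp : p ∈ Bcyl) : |f p - f 0| ≤ K * (p.1 + p.2.1 + p.2.2) := by
  obtain ⟨hx, -, hy, hz, -⟩ := hp
  have hnorm : ‖p‖ ≤ p.1 + p.2.1 + p.2.2 := by
    rw [Prod.norm_def, Prod.norm_def, Real.norm_of_nonneg hx, Real.norm_of_nonneg hy,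
      Real.norm_of_nonneg hz]
    refine max_le ?_ (max_le ?_ ?_) <;> linarith
  have := hf.dist_le_mul p 0
  rw [Real.dist_eq, dist_zero_right] at this
  exact this.trans (mul_le_mul_of_nonneg_left hnorm K.2)

/-- inverse weight transition through a three-dimensional saddle,
second case: if `D' ⊆ (0,1) × (0,1)` has weight `ρ'' > 0` and `S'_z` is the
saturation of `Φ̄(D')` by the `ξ`-flow in `B`, then
`φₓ⁻¹(S'_z) = {(u,v) ∈ ℝ²_{>0} : (1,u,v) ∈ S'_z}` has weight
`(μρ'')/(1 + λρ'')`. -/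
theorem inverse_weight_transition_second_case
    (lam mu : ℝ) (hlam : 0 < lam) (hmu : 0 < mu)
    (V : Set (ℝ × ℝ × ℝ)) (hVopen : IsOpen V) (hBV : Bcyl ⊆ V)
    (a b c : ℝ × ℝ × ℝ → ℝ)
    (ha : AnalyticOnNhd ℝ a V) (hb : AnalyticOnNhd ℝ b V) (hc : AnalyticOnNhd ℝ c V)
    (ha0 : a (0, 0, 0) = 0) (hb0 : b (0, 0, 0) = 0) (hc0 : c (0, 0, 0) = 0)
    (ξ : ℝ × ℝ × ℝ → ℝ × ℝ × ℝ)
    (hξ : ∀ p : ℝ × ℝ × ℝ,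
      ξ p = ((1 + a p) * p.1, (-lam + b p) * p.2.1, (-mu + c p) * p.2.2))
    (htrans1 : ∀ p ∈ Bcyl, 0 < 1 + a p)
    (htrans2 : ∀ p ∈ Bcyl, (p.2.1, p.2.2) ≠ ((0 : ℝ), (0 : ℝ)) →
      (-lam + b p) * p.2.1 ^ 2 + (-mu + c p) * p.2.2 ^ 2 < 0)
    (D' : Set (ℝ × ℝ)) (hD' : D' ⊆ Set.Ioo (0 : ℝ) 1 ×ˢ Set.Ioo (0 : ℝ) 1)
    (ρ'' : ℝ) (hρ'' : 0 < ρ'') (hw : SetHasWeight D' ρ'')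
    (S'z : Set (ℝ × ℝ × ℝ)) (hS'z : S'z = Saturation ξ (fencePhiBar '' D')) :
    SetHasWeight {q : ℝ × ℝ | 0 < q.1 ∧ 0 < q.2 ∧ phiX q ∈ S'z}
      (mu * ρ'' / (1 + lam * ρ'')) := by
  set V' := V ∩ {p | 0 < 1 + a p} with hV'
  have hV'open : IsOpen V' :=
    (continuousOn_const.add ha.continuousOn).isOpen_inter_preimage hVopen isOpen_Ioi
  have hBV' : Bcyl ⊆ V' := fun p hp => ⟨hBV hp, htrans1 p hp⟩
  set β : ℝ × ℝ × ℝ → ℝ := fun p => (-lam + b p) / (1 + a p) with hβ_def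
  set γ : ℝ × ℝ × ℝ → ℝ := fun p => (-mu + c p) / (1 + a p) with hγ_def
  have hαan : AnalyticOnNhd ℝ (fun p => 1 + a p) V' := fun p hp =>
    analyticAt_const.add (ha p hp.1)
  have hβan : AnalyticOnNhd ℝ β V' := fun p hp =>
    (analyticAt_const.add (hb p hp.1)).div (hαan p hp) (ne_of_gt hp.2)
  have hγan : AnalyticOnNhd ℝ γ V' := fun p hp =>
    (analyticAt_const.add (hc p hp.1)).div (hαan p hp) (ne_of_gt hp.2)
  have hGan : AnalyticOnNhd ℝ
      (fun p : ℝ × ℝ × ℝ => (p.1, β p * p.2.1, γ p * p.2.2)) V' := fun p hp =>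
    analyticAt_fst.prod (((hβan p hp).mul (analyticAt_fst.comp analyticAt_snd)).prod
      ((hγan p hp).mul (analyticAt_snd.comp analyticAt_snd)))
  obtain ⟨χ, hχ, hχc, hχs, hχ01, hχ1⟩ := exists_contDiff_cutoff hV'open isCompact_Bcyl hBV'
  have hχB (p : ℝ × ℝ × ℝ) (hp : p ∈ Bcyl) : χ p = 1 := (hχ1 p hp).self_of_nhds
  obtain ⟨⟨K, hK⟩, L, hL⟩ := exists_lipschitzWith_cutoff_smul hχ hχc hχs hGan
  obtain ⟨⟨Kβ, hKβ⟩, -⟩ := exists_lipschitzWith_cutoff_smul hχ hχc hχs hβan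
  obtain ⟨⟨Kγ, hKγ⟩, -⟩ := exists_lipschitzWith_cutoff_smul hχ hχc hχs hγan
  obtain ⟨⟨Ka, hKa⟩, La, hLa⟩ := exists_lipschitzWith_cutoff_smul hχ hχc hχs
    (ha.mono (inter_subset_left : V' ⊆ V))
  simp only [smul_eq_mul] at hKβ hKγ hKa hLa
  have hG_an (p : ℝ × ℝ × ℝ) (hp : p ∈ Bcyl) :
      AnalyticAt ℝ (fun p : ℝ × ℝ × ℝ => χ p • (p.1, β p * p.2.1, γ p * p.2.2)) p := by
    refine (hGan p (hBV' hp)).congr ?_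
    filter_upwards [hχ1 p hp] with q hq
    rw [hq, one_smul]
  obtain ⟨φ, hφ0, hφ⟩ := exists_flow_of_lipschitzWith hK hL
  have hflow : IsSaddleFlow β γ χ φ :=
    ⟨hχ.continuous, hKβ.continuous, hKγ.continuous, fun p => (hχ01 p).1, fun p => (hχ01 p).2,
      hχB, hφ0, hφ⟩
  have htrans (p : ℝ × ℝ × ℝ) (hp : p ∈ Bcyl) (hne : (p.2.1, p.2.2) ≠ ((0 : ℝ), (0 : ℝ))) :
      β p * p.2.1 ^ 2 + γ p * p.2.2 ^ 2 < 0 := by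
    have : β p * p.2.1 ^ 2 + γ p * p.2.2 ^ 2
        = ((-lam + b p) * p.2.1 ^ 2 + (-mu + c p) * p.2.2 ^ 2) / (1 + a p) := by
      simp only [hβ_def, hγ_def]
      ring
    rw [this]
    exact div_neg_of_neg_of_pos (htrans2 p hp hne) (htrans1 p hp)
  have h0 : (0 : ℝ × ℝ × ℝ) ∈ Bcyl := by simp [Bcyl]
  have hbound {K' : NNReal} {f : ℝ × ℝ × ℝ → ℝ} {l : ℝ}
      (hf : LipschitzWith K' fun p => χ p * f p) (hf0 : f 0 = -l) (hK' : K' ≤ max Kβ Kγ)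
      (p : ℝ × ℝ × ℝ) (hp : p ∈ Bcyl) :
      |f p + l| ≤ (max Kβ Kγ : NNReal) * (p.1 + p.2.1 + p.2.2) := by
    have := abs_sub_le_of_lipschitzWith_Bcyl (hf.weaken hK') hp
    rwa [hχB p hp, hχB 0 h0, hf0, one_mul, one_mul, sub_neg_eq_add] at this
  have hβ0 : β 0 = -lam := by
    have ha0' : a 0 = 0 := ha0
    have hb0' : b 0 = 0 := hb0
    simp [hβ_def, ha0', hb0']
  have hγ0 : γ 0 = -mu := by
    have ha0' : a 0 = 0 := ha0
    have hc0' : c 0 = 0 := hc0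
    simp [hγ_def, ha0', hc0']
  obtain ⟨κ, hκ, hκle⟩ := isCompact_Bcyl.exists_forall_le' (a := 0)
    (f := fun p => 1 + a p) ((hαan.continuousOn).mono hBV') htrans1
  have hα : LipschitzWith Ka fun p => max κ (1 + χ p * a p) := by
    simpa using (((LipschitzWith.const (1 : ℝ)).add hKa).const_max κ)
  have hξ' (p : ℝ × ℝ × ℝ) (hp : p ∈ Bcyl) :
      ξ p = (max κ (1 + χ p * a p)) • (p.1, β p * p.2.1, γ p * p.2.2) := by
    have hne := (htrans1 p hp).ne'
    rw [hχB p hp, one_mul, max_eq_right (hκle p hp), hξ]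
    simp only [Prod.smul_mk, smul_eq_mul, hβ_def, hγ_def]
    rw [← mul_assoc, ← mul_assoc, mul_div_cancel₀ _ hne, mul_div_cancel₀ _ hne]
  have hαA (p : ℝ × ℝ × ℝ) :
      ‖max κ (1 + χ p * a p)‖ ≤ ((max κ (1 + La)).toNNReal : ℝ) := by
    have hle : χ p * a p ≤ La := (le_abs_self _).trans (hLa p)
    rw [Real.norm_of_nonneg (hκ.le.trans (le_max_left _ _))]
    refine le_trans ?_ (Real.le_coe_toNNReal _)
    gcongr
  obtain ⟨w, hw1, hw2, rfl⟩ := hw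
  obtain ⟨hd1, hd2⟩ := hflow.weight_transition hK hG_an htrans hlam hmu (NNReal.coe_nonneg _)
    (hβan.continuousOn.mono hBV') (hγan.continuousOn.mono hBV')
    (hbound hKβ hβ0 (le_max_left _ _)) (hbound hKγ hγ0 (le_max_right _ _)) hρ'' hw1 hw2
    fun t ht => hD' (mem_image_of_mem w ht)
  refine ⟨_, hd1, hd2, ?_⟩
  rw [hS'z, hflow.setOf_phiX_mem_saturation hK hL htrans hα hκ (fun p => le_max_left _ _) hαA
    hξ' hD', image_image]
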